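/- Theorem of Noether and Castelnuovo: the plane Cremona group Bir(ℙ²_ℂ) is generated by the standard quadratic involution σ₂ together with the group of linear (projective) automorphisms Aut(ℙ²_ℂ) = PGL(3,ℂ); that is, the subgroup of Aut_ℂ(ℂ(x,y)) generated by σ₂ and by all linear automorphisms is the whole group Aut_ℂ(ℂ(x,y)). -/

import Mathlib

set_option autoImplicit false

noncomputable section

/-- The field `ℂ(x,y)` of rational functions in two variables over `ℂ`. -/
abbrev K2 : Type := FractionRing (MvPolynomial (Fin 2) ℂ)

/-- The plane Cremona group `Bir(ℙ²_ℂ)`, identified with the group `Aut_ℂ(ℂ(x,y))`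
of `ℂ`-algebra automorphisms of `ℂ(x,y)`. -/
abbrev Cremona2 : Type := K2 ≃ₐ[ℂ] K2

/-- The coordinate function `x`. -/
def X0 : K2 := algebraMap (MvPolynomial (Fin 2) ℂ) K2 (MvPolynomial.X 0)

/-- The coordinate function `y`. -/
def X1 : K2 := algebraMap (MvPolynomial (Fin 2) ℂ) K2 (MvPolynomial.X 1)

/-- The degree-one rational function `a·x + b·y + c` in `ℂ(x,y)`. -/
def lin2 (a b c : ℂ) : K2 :=
  algebraMap ℂ K2 a * X0 + algebraMap ℂ K2 b * X1 + algebraMap ℂ K2 c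

/-- `f ∈ Bir(ℙ²_ℂ)` is a linear (projective) automorphism: there is an invertible
`3×3` complex matrix `A = (a_{ij})` with
`f(x) = (a₀₀x + a₀₁y + a₀₂)/(a₂₀x + a₂₁y + a₂₂)` and
`f(y) = (a₁₀x + a₁₁y + a₁₂)/(a₂₀x + a₂₁y + a₂₂)`. -/
def IsLinearAut (f : Cremona2) : Prop :=
  ∃ A : Matrix (Fin 3) (Fin 3) ℂ, IsUnit A ∧
    f X0 = lin2 (A 0 0) (A 0 1) (A 0 2) / lin2 (A 2 0) (A 2 1) (A 2 2) ∧
    f X1 = lin2 (A 1 0) (A 1 1) (A 1 2) / lin2 (A 2 0) (A 2 1) (A 2 2)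

namespace PlaneCremona

open MvPolynomial

/-- Substitution of a pair of rational functions into a polynomial in two variables. -/
def ev (s t : K2) : MvPolynomial (Fin 2) ℂ →ₐ[ℂ] K2 := aeval ![s, t]

@[simp] lemma ev_X_zero (s t : K2) : ev s t (X 0) = s := by simp [ev]

@[simp] lemma ev_X_one (s t : K2) : ev s t (X 1) = t := by simp [ev]

@[simp] lemma ev_C (s t : K2) (c : ℂ) : ev s t (C c) = algebraMap ℂ K2 c := by simp [ev]

lemma ev_monomial (s t : K2) (d : Fin 2 →₀ ℕ) (c : ℂ) :
    ev s t (monomial d c) = algebraMap ℂ K2 c * (s ^ d 0 * t ^ d 1) := by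
  simp [ev, aeval_monomial, Finsupp.prod_fintype, Fin.prod_univ_two]

lemma ev_eq_sum (s t : K2) (P : MvPolynomial (Fin 2) ℂ) :
    ev s t P = ∑ d ∈ P.support, algebraMap ℂ K2 (P.coeff d) * (s ^ d 0 * t ^ d 1) := by
  conv_lhs => rw [P.as_sum, map_sum]
  simp only [ev_monomial]

lemma ev_X0_X1 (P : MvPolynomial (Fin 2) ℂ) : ev X0 X1 P = algebraMap _ K2 P := by
  have : ev X0 X1 = IsScalarTower.toAlgHom ℂ (MvPolynomial (Fin 2) ℂ) K2 := by
    ext i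
    fin_cases i <;> simp [ev, X0, X1]
  rw [this]; rfl

lemma map_ev {L : Type*} [FunLike L K2 K2] [AlgHomClass L ℂ K2 K2] (f : L) (s t : K2)
    (P : MvPolynomial (Fin 2) ℂ) : f (ev s t P) = ev (f s) (f t) P := by
  have : (AlgHomClass.toAlgHom f).comp (ev s t) = ev (f s) (f t) := by
    ext i
    fin_cases i <;> simp [ev]
  exact DFunLike.congr_fun this P

lemma exists_eq_div (z : K2) :
    ∃ P Q : MvPolynomial (Fin 2) ℂ, Q ≠ 0 ∧ z = ev X0 X1 P / ev X0 X1 Q := by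
  obtain ⟨P, Q, hQ, rfl⟩ := IsFractionRing.div_surjective (A := MvPolynomial (Fin 2) ℂ) z
  exact ⟨P, Q, nonZeroDivisors.ne_zero hQ, by rw [ev_X0_X1, ev_X0_X1]⟩

lemma ev_X0_X1_injective : Function.Injective (ev X0 X1) := by
  intro P Q h
  rw [ev_X0_X1, ev_X0_X1] at h
  exact IsFractionRing.injective _ _ h

lemma ev_X0_X1_ne_zero {P : MvPolynomial (Fin 2) ℂ} (h : P ≠ 0) : ev X0 X1 P ≠ 0 := by
  rwa [← map_zero (ev X0 X1), ev_X0_X1_injective.ne_iff]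

lemma hom_ext_K2 {L : Type*} [Field L] [Algebra ℂ L] {f g : K2 →ₐ[ℂ] L} (h0 : f X0 = g X0)
    (h1 : f X1 = g X1) : f = g := by
  apply IsLocalization.algHom_ext (nonZeroDivisors (MvPolynomial (Fin 2) ℂ))
  ext i
  fin_cases i
  · exact h0
  · exact h1

lemma cremona_ext {f g : Cremona2} (h0 : f X0 = g X0) (h1 : f X1 = g X1) : f = g := by
  have : (f : K2 →ₐ[ℂ] K2) = g := hom_ext_K2 h0 h1
  ext z
  exact DFunLike.congr_fun this z

lemma X0_ne_zero : X0 ≠ 0 := by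
  simpa using ev_X0_X1_ne_zero (X_ne_zero (0 : Fin 2) : (X 0 : MvPolynomial (Fin 2) ℂ) ≠ 0)

lemma X1_ne_zero : X1 ≠ 0 := by
  simpa using ev_X0_X1_ne_zero (X_ne_zero (1 : Fin 2) : (X 1 : MvPolynomial (Fin 2) ℂ) ≠ 0)

lemma exists_hom {s t : K2} (h : Function.Injective (ev s t)) :
    ∃ f : K2 →ₐ[ℂ] K2, f X0 = s ∧ f X1 = t := by
  refine ⟨IsFractionRing.liftAlgHom h, ?_, ?_⟩
  · simp [X0]
  · simp [X1]

lemma exists_cremona {s t : K2} (h : Function.Injective (ev s t)) {f : K2 →ₐ[ℂ] K2}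
    (hs : f s = X0) (ht : f t = X1) :
    ∃ g : Cremona2, g X0 = s ∧ g X1 = t := by
  obtain ⟨g, hg0, hg1⟩ := exists_hom h
  have h1 : f.comp g = AlgHom.id ℂ K2 := hom_ext_K2 (by simp [hg0, hs]) (by simp [hg1, ht])
  have h2 : g.comp f = AlgHom.id ℂ K2 :=
    AlgHom.ext fun z => RingHom.injective (f : K2 →+* K2) (DFunLike.congr_fun h1 (f z))
  exact ⟨AlgEquiv.ofAlgHom g f h2 h1, hg0, hg1⟩

/-- Polynomial automorphisms of the plane are Cremona transformations. -/
lemma exists_cremona_of_polynomial {p q p' q' : MvPolynomial (Fin 2) ℂ}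
    (h0 : aeval ![p', q'] p = X 0) (h1 : aeval ![p', q'] q = X 1)
    (h0' : aeval ![p, q] p' = X 0) (h1' : aeval ![p, q] q' = X 1) :
    ∃ g : Cremona2, g X0 = ev X0 X1 p ∧ g X1 = ev X0 X1 q := by
  let e : MvPolynomial (Fin 2) ℂ ≃ₐ[ℂ] MvPolynomial (Fin 2) ℂ :=
    AlgEquiv.ofAlgHom (aeval ![p, q]) (aeval ![p', q'])
      (algHom_ext fun i => by
        fin_cases i
        · simpa [-aeval_eq_bind₁] using h0'
        · simpa [-aeval_eq_bind₁] using h1')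
      (algHom_ext fun i => by
        fin_cases i
        · simpa [-aeval_eq_bind₁] using h0
        · simpa [-aeval_eq_bind₁] using h1)
  refine ⟨IsFractionRing.algEquivOfAlgEquiv e, ?_, ?_⟩
  · rw [ev_X0_X1, X0, IsFractionRing.algEquivOfAlgEquiv_algebraMap]
    simp [e]
  · rw [ev_X0_X1, X1, IsFractionRing.algEquivOfAlgEquiv_algebraMap]
    simp [e]

/-- The image of `P` under the map of monomials induced by a map `e` of exponents. -/
def reindex (e : (Fin 2 →₀ ℕ) → (Fin 2 →₀ ℕ)) (P : MvPolynomial (Fin 2) ℂ) :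
    MvPolynomial (Fin 2) ℂ := ∑ d ∈ P.support, monomial (e d) (P.coeff d)

lemma ev_reindex {e : (Fin 2 →₀ ℕ) → (Fin 2 →₀ ℕ)} {P : MvPolynomial (Fin 2) ℂ} {s t s' t' κ : K2}
    (h : ∀ d ∈ P.support, s' ^ e d 0 * t' ^ e d 1 = κ * (s ^ d 0 * t ^ d 1)) :
    ev s' t' (reindex e P) = κ * ev s t P := by
  rw [reindex, map_sum, ev_eq_sum s t, Finset.mul_sum]
  refine Finset.sum_congr rfl fun d hd => ?_
  rw [ev_monomial, h d hd]
  ring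

lemma reindex_ne_zero {e : (Fin 2 →₀ ℕ) → (Fin 2 →₀ ℕ)} {P : MvPolynomial (Fin 2) ℂ} (hP : P ≠ 0)
    (he : Set.InjOn e P.support) : reindex e P ≠ 0 := by
  classical
  obtain ⟨d, hd⟩ := Finset.nonempty_iff_ne_empty.mpr (mt support_eq_empty.mp hP)
  intro h0
  have h1 : (reindex e P).coeff (e d) = P.coeff d := by
    rw [reindex, coeff_sum, Finset.sum_eq_single d]
    · simp
    · intro b hb hbd
      rw [coeff_monomial, if_neg]
      exact fun h => hbd (he hb hd h)
    · exact fun h => absurd hd h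
  rw [h0, coeff_zero] at h1
  exact mem_support_iff.mp hd h1.symm

/-- The exponent vector `(i, j)`. -/
def expo (i j : ℕ) : Fin 2 →₀ ℕ := Finsupp.equivFunOnFinite.symm ![i, j]

@[simp] lemma expo_zero (i j : ℕ) : expo i j 0 = i := by simp [expo]

@[simp] lemma expo_one (i j : ℕ) : expo i j 1 = j := by simp [expo]

lemma expo_ext {d e : Fin 2 →₀ ℕ} (h0 : d 0 = e 0) (h1 : d 1 = e 1) : d = e := by
  ext i
  fin_cases i
  · exact h0
  · exact h1

lemma ev_flip_injective : Function.Injective (ev X0⁻¹ (X1 * X0⁻¹)) := by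
  rw [injective_iff_map_eq_zero]
  intro P hP
  by_contra h
  have hdeg : ∀ d ∈ P.support, d 0 + d 1 ≤ P.totalDegree := by
    intro d hd
    have := le_totalDegree hd
    rwa [Finsupp.sum_fintype _ _ (by simp), Fin.sum_univ_two] at this
  have h1 : ev X0 X1 (reindex (fun d => expo (P.totalDegree - d 0 - d 1) (d 1)) P) =
      X0 ^ P.totalDegree * ev X0⁻¹ (X1 * X0⁻¹) P := by
    refine ev_reindex fun d hd => ?_
    obtain ⟨k, hk⟩ := Nat.exists_eq_add_of_le (hdeg d hd)
    have hX := X0_ne_zero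
    rw [hk, expo_zero, expo_one, show d 0 + d 1 + k - d 0 - d 1 = k by omega, mul_pow, inv_pow, inv_pow, pow_add, pow_add]
    field_simp
  rw [hP, mul_zero] at h1
  refine ev_X0_X1_ne_zero (reindex_ne_zero h ?_) h1
  intro d hd d' hd' hdd
  have e0 := DFunLike.congr_fun hdd 0
  have e1 := DFunLike.congr_fun hdd 1
  have := hdeg d hd
  have := hdeg d' hd'
  simp only [expo_zero, expo_one] at e0 e1
  exact expo_ext (by omega) e1

lemma exists_flip : ∃ g : Cremona2, g X0 = X0⁻¹ ∧ g X1 = X1 * X0⁻¹ := by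
  obtain ⟨f, hf0, hf1⟩ := exists_hom ev_flip_injective
  refine exists_cremona ev_flip_injective (f := f) (by simp [hf0]) ?_
  rw [map_mul, map_inv₀, hf0, hf1]
  have := X0_ne_zero
  field_simp

lemma inv_eq_homography {F : Type*} [Field F] (t : F) (ht : t ≠ 0) :
    t⁻¹ = -1 * (t + 1) * (1 + -1 * (t + 1))⁻¹ + -1 := by
  have h : 1 + -1 * (t + 1) = -t := by ring
  rw [h, inv_neg]
  field_simp
  ring

lemma affine_eq {F : Type*} [Field F] (a b d t : F) (hd : d ≠ 0) :
    (a * t + b) / (0 * t + d) = t * (a / d) + b / d := by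
  rw [zero_mul, zero_add]
  field_simp

lemma moebius_eq {F : Type*} [Field F] (a b c d t : F) (hc : c ≠ 0) (h : c * t + d ≠ 0) :
    (a * t + b) / (c * t + d) = (t * c + d)⁻¹ * (-(a * d - b * c) / c) + a / c := by
  rw [mul_comm c t] at h ⊢
  field_simp
  ring

/-- A set of Cremona transformations that is stable under right multiplication by linear
automorphisms and by the standard quadratic involution. -/
structure RightStable (S : Set Cremona2) : Prop where
  mul_linear : ∀ ψ ∈ S, ∀ g : Cremona2, IsLinearAut g → ψ * g ∈ S
  mul_quadratic : ∀ ψ ∈ S, ∀ g : Cremona2, g X0 = X0⁻¹ → g X1 = X1⁻¹ → ψ * g ∈ S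
  exists_quadratic : ∃ g : Cremona2, g X0 = X0⁻¹ ∧ g X1 = X1⁻¹

/-- The pair `(s, t)` is the image of `(x, y)` under an element of `S`. -/
def Pt (S : Set Cremona2) (s t : K2) : Prop := ∃ ψ ∈ S, ψ X0 = s ∧ ψ X1 = t

namespace Pt

variable {S : Set Cremona2} {s t : K2}

lemma injective (h : Pt S s t) : Function.Injective (ev s t) := by
  obtain ⟨ψ, -, rfl, rfl⟩ := h
  intro P Q hPQ
  rw [← map_ev, ← map_ev] at hPQ
  exact ev_X0_X1_injective (ψ.injective hPQ)

lemma ev_ne_zero (h : Pt S s t) {P : MvPolynomial (Fin 2) ℂ} (hP : P ≠ 0) : ev s t P ≠ 0 := by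
  rwa [← map_zero (ev s t), h.injective.ne_iff]

lemma left_ne_zero (h : Pt S s t) : s ≠ 0 := by
  simpa using h.ev_ne_zero (X_ne_zero 0)

lemma right_ne_zero (h : Pt S s t) : t ≠ 0 := by
  simpa using h.ev_ne_zero (X_ne_zero 1)

lemma X_add_C_ne_zero (i : Fin 2) (c : ℂ) : (X i + C c : MvPolynomial (Fin 2) ℂ) ≠ 0 := by
  intro h
  have h1 := congrArg (eval fun _ => 1 - c) h
  simp at h1

lemma left_add_ne_zero (h : Pt S s t) (c : ℂ) : s + algebraMap ℂ K2 c ≠ 0 := by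
  simpa using h.ev_ne_zero (X_add_C_ne_zero 0 c)

lemma of_linear (hS : RightStable S) (h : Pt S s t) {g : Cremona2} {p q : K2} (h0 : g X0 = p)
    (h1 : g X1 = q) (A : Matrix (Fin 3) (Fin 3) ℂ) (hA : A.det ≠ 0)
    (hp : p = lin2 (A 0 0) (A 0 1) (A 0 2) / lin2 (A 2 0) (A 2 1) (A 2 2))
    (hq : q = lin2 (A 1 0) (A 1 1) (A 1 2) / lin2 (A 2 0) (A 2 1) (A 2 2)) :
    ∀ f : K2 →ₐ[ℂ] K2, f X0 = s → f X1 = t → Pt S (f p) (f q) := by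
  obtain ⟨ψ, hψ, rfl, rfl⟩ := h
  intro f hf0 hf1
  have : f = ψ := hom_ext_K2 hf0 hf1
  subst this
  refine ⟨ψ * g, hS.mul_linear ψ hψ g ⟨A, ?_, ?_, ?_⟩, ?_, ?_⟩
  · exact (Matrix.isUnit_iff_isUnit_det A).mpr (isUnit_iff_ne_zero.mpr hA)
  · rw [h0, hp]
  · rw [h1, hq]
  · simp [h0]
  · simp [h1]

lemma exists_algHom (h : Pt S s t) : ∃ f : K2 →ₐ[ℂ] K2, f X0 = s ∧ f X1 = t := by
  obtain ⟨ψ, -, h0, h1⟩ := h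
  exact ⟨ψ, h0, h1⟩

lemma add_left (hS : RightStable S) (h : Pt S s t) (c : ℂ) : Pt S (s + algebraMap ℂ K2 c) t := by
  obtain ⟨f, hf0, hf1⟩ := h.exists_algHom
  obtain ⟨g, h0, h1⟩ := exists_cremona_of_polynomial (p := X 0 + C c) (q := X 1)
    (p' := X 0 - C c) (q' := X 1) (by simp) (by simp) (by simp) (by simp)
  have := of_linear hS h h0 h1 !![1, 0, c; 0, 1, 0; 0, 0, 1] (by simp [Matrix.det_fin_three])
    (by simp [lin2]) (by simp [lin2]) f hf0 hf1
  simpa [hf0, hf1] using this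

lemma swap (hS : RightStable S) (h : Pt S s t) : Pt S t s := by
  obtain ⟨f, hf0, hf1⟩ := h.exists_algHom
  obtain ⟨g, h0, h1⟩ := exists_cremona_of_polynomial (p := X 1) (q := X 0)
    (p' := X 1) (q' := X 0) (by simp) (by simp) (by simp) (by simp)
  have := of_linear hS h h0 h1 !![0, 1, 0; 1, 0, 0; 0, 0, 1] (by simp [Matrix.det_fin_three])
    (by simp [lin2]) (by simp [lin2]) f hf0 hf1
  simpa [hf0, hf1] using this

lemma add_right (hS : RightStable S) (h : Pt S s t) (c : ℂ) : Pt S s (t + algebraMap ℂ K2 c) :=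
  ((h.swap hS).add_left hS c).swap hS

lemma smul_right (hS : RightStable S) (h : Pt S s t) {c : ℂ} (hc : c ≠ 0) :
    Pt S s (algebraMap ℂ K2 c * t) := by
  obtain ⟨f, hf0, hf1⟩ := h.exists_algHom
  obtain ⟨g, h0, h1⟩ := exists_cremona_of_polynomial (p := X 0) (q := C c * X 1)
    (p' := X 0) (q' := C c⁻¹ * X 1) (by simp)
    (by simp [algebraMap_eq, ← mul_assoc, ← C_mul, hc]) (by simp)
    (by simp [algebraMap_eq, ← mul_assoc, ← C_mul, hc])
  have := of_linear hS h h0 h1 !![1, 0, 0; 0, c, 0; 0, 0, 1] (by simp [Matrix.det_fin_three, hc])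
    (by simp [lin2]) (by simp [lin2]) f hf0 hf1
  simpa [hf0, hf1] using this

lemma shear (hS : RightStable S) (h : Pt S s t) : Pt S s (t + s) := by
  obtain ⟨f, hf0, hf1⟩ := h.exists_algHom
  obtain ⟨g, h0, h1⟩ := exists_cremona_of_polynomial (p := X 0) (q := X 1 + X 0)
    (p' := X 0) (q' := X 1 - X 0) (by simp) (by simp) (by simp) (by simp)
  have := of_linear hS h h0 h1 !![1, 0, 0; 1, 1, 0; 0, 0, 1] (by simp [Matrix.det_fin_three])
    (by simp [lin2]) (by simp [lin2, add_comm]) f hf0 hf1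
  simpa [hf0, hf1] using this

lemma flip (hS : RightStable S) (h : Pt S s t) : Pt S s⁻¹ (t * s⁻¹) := by
  obtain ⟨f, hf0, hf1⟩ := h.exists_algHom
  obtain ⟨g, h0, h1⟩ := exists_flip
  have := of_linear hS h h0 h1 !![0, 0, 1; 0, 1, 0; 1, 0, 0] (by simp [Matrix.det_fin_three])
    (by simp [lin2]) (by simp [lin2, div_eq_mul_inv]) f hf0 hf1
  simpa [hf0, hf1] using this

lemma quadratic (hS : RightStable S) (h : Pt S s t) : Pt S s⁻¹ t⁻¹ := by
  obtain ⟨ψ, hψ, rfl, rfl⟩ := h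
  obtain ⟨g, h0, h1⟩ := hS.exists_quadratic
  exact ⟨ψ * g, hS.mul_quadratic ψ hψ g h0 h1, by simp [h0], by simp [h1]⟩

/-- The transformation `(s, t) ↦ (s, s / t)`. -/
lemma div_swap (hS : RightStable S) (h : Pt S s t) : Pt S s (s * t⁻¹) := by
  simpa using (h.flip hS).quadratic hS

lemma homography (hS : RightStable S) (h : Pt S s t) : Pt S s (t * (1 + t)⁻¹) := by
  convert ((h.div_swap hS).shear hS).div_swap hS using 1
  have h0 := h.left_ne_zero
  have h1 := h.right_ne_zero
  have h2 : s * t⁻¹ + s = s * ((1 + t) * t⁻¹) := by field_simp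
  rw [h2, mul_inv, mul_inv, inv_inv, ← mul_assoc, mul_inv_cancel₀ h0, one_mul, mul_comm]

lemma inv_right (hS : RightStable S) (h : Pt S s t) : Pt S s t⁻¹ := by
  convert ((((h.add_right hS 1).smul_right hS (neg_ne_zero.mpr one_ne_zero)).homography hS).add_right
    hS (-1)) using 1
  simpa only [map_neg, map_one] using inv_eq_homography t h.right_ne_zero

lemma inv_left (hS : RightStable S) (h : Pt S s t) : Pt S s⁻¹ t :=
  ((h.swap hS).inv_right hS).swap hS

lemma mul_left (hS : RightStable S) (h : Pt S s t) : Pt S s (s * t) := by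
  simpa using (h.inv_right hS).div_swap hS

lemma mul_zpow (hS : RightStable S) (h : Pt S s t) (n : ℤ) : Pt S s (t * s ^ n) := by
  have h0 := h.left_ne_zero
  induction n with
  | zero => simpa using h
  | succ n ih =>
    convert ih.mul_left hS using 1
    rw [zpow_add_one₀ h0]
    ring
  | pred n ih =>
    convert (ih.div_swap hS).inv_right hS using 1
    rw [zpow_sub_one₀ h0, mul_inv, inv_inv]
    ring

lemma mul_aeval (hS : RightStable S) (h : Pt S s t) {p : Polynomial ℂ} (hp : p ≠ 0) :
    Pt S s (t * Polynomial.aeval s p) := by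
  have key : ∀ m : Multiset ℂ, Pt S s (t * (m.map fun c => s - algebraMap ℂ K2 c).prod) := by
    intro m
    induction m using Multiset.induction_on with
    | empty => simpa using h
    | cons c m ih =>
      convert ((ih.add_left hS (-c)).mul_left hS).add_left hS c using 1
      · simp
      · rw [Multiset.map_cons, Multiset.prod_cons, map_neg]
        ring
  have h1 := (key p.roots).smul_right hS (Polynomial.leadingCoeff_ne_zero.mpr hp)
  convert h1 using 1
  conv_lhs => rw [(IsAlgClosed.splits p).eq_prod_roots]
  rw [map_mul, map_multiset_prod, Multiset.map_map]
  simp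
  ring

lemma mul_adjoin (hS : RightStable S) (h : Pt S s t) {r : K2}
    (hr : r ∈ IntermediateField.adjoin ℂ {s}) (hr0 : r ≠ 0) : Pt S s (t * r) := by
  obtain ⟨p, q, rfl⟩ := (IntermediateField.mem_adjoin_simple_iff ℂ r).mp hr
  have hp : p ≠ 0 := by rintro rfl; simp at hr0
  have hq : q ≠ 0 := by rintro rfl; simp at hr0
  convert (((h.mul_aeval hS hp).inv_right hS).mul_aeval hS hq).inv_right hS using 1
  rw [mul_inv, inv_inv, div_eq_mul_inv]
  ring

lemma add_adjoin (hS : RightStable S) (h : Pt S s t) {r : K2}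
    (hr : r ∈ IntermediateField.adjoin ℂ {s}) : Pt S s (t + r) := by
  rcases eq_or_ne r 0 with rfl | hr0
  · simpa using h
  convert (((h.mul_adjoin hS (inv_mem hr) (inv_ne_zero hr0)).add_right hS 1).mul_adjoin hS hr hr0) using 1
  rw [map_one]
  field_simp

/-- Möbius transformations in `t` with coefficients in `ℂ(s)`. -/
lemma moebius (hS : RightStable S) (h : Pt S s t) {a b c d t' : K2}
    (ha : a ∈ IntermediateField.adjoin ℂ {s}) (hb : b ∈ IntermediateField.adjoin ℂ {s})
    (hc : c ∈ IntermediateField.adjoin ℂ {s}) (hd : d ∈ IntermediateField.adjoin ℂ {s})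
    (hdet : a * d - b * c ≠ 0) (hcd : c * t + d ≠ 0) (ht' : t' * (c * t + d) = a * t + b) :
    Pt S s t' := by
  have htc : t' = (a * t + b) / (c * t + d) := by rw [← ht']; field_simp
  rcases eq_or_ne c 0 with rfl | hc0
  · have hd0 : d ≠ 0 := by rintro rfl; simp at hcd
    have ha0 : a ≠ 0 := by rintro rfl; simp at hdet
    convert (h.mul_adjoin hS (div_mem ha hd) (div_ne_zero ha0 hd0)).add_adjoin hS (div_mem hb hd) using 1
    rw [htc]
    exact affine_eq _ _ _ _ hd0
  · have h1 := ((h.mul_adjoin hS hc hc0).add_adjoin hS hd).inv_right hS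
    have h2 := (h1.mul_adjoin hS (div_mem (neg_mem (sub_mem (mul_mem ha hd) (mul_mem hb hc))) hc)
      (div_ne_zero (neg_ne_zero.mpr hdet) hc0)).add_adjoin hS (div_mem ha hc)
    convert h2 using 1
    rw [htc]
    exact moebius_eq _ _ _ _ _ hc0 hcd

end Pt

/-- Two generators of a purely transcendental extension of transcendence degree one
differ by a Möbius transformation. -/
lemma exists_moebius_of_adjoin_eq_top {F E : Type*} [Field F] [Field E] [Algebra F E] {x y : E}
    (hx : Transcendental F x) (hxt : IntermediateField.adjoin F {x} = ⊤)
    (hyt : IntermediateField.adjoin F {y} = ⊤) :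
    ∃ a b c d : F, a * d - b * c ≠ 0 ∧ algebraMap F E c * x + algebraMap F E d ≠ 0 ∧
      y * (algebraMap F E c * x + algebraMap F E d) = algebraMap F E a * x + algebraMap F E b := by
  let e := RatFunc.algEquivOfTranscendental x hx
  let φ : RatFunc F →ₐ[F] E := (IntermediateField.adjoin F {x}).val.comp e
  have hφX : φ RatFunc.X = x := by simp [φ, e]
  have hy : y ∈ IntermediateField.adjoin F {x} := hxt ▸ IntermediateField.mem_top
  let f := e.symm ⟨y, hy⟩
  have hφf : φ f = y := by simp [φ, f]
  have hf : IntermediateField.adjoin F {f} = ⊤ := by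
    rw [eq_top_iff, ← RatFunc.adjoin_X, IntermediateField.adjoin_simple_le_iff]
    have h1 : φ RatFunc.X ∈ (IntermediateField.adjoin F {f}).map φ := by
      rw [IntermediateField.adjoin_map, Set.image_singleton, hφf, hyt]
      exact IntermediateField.mem_top
    obtain ⟨z, hz, hzX⟩ := h1
    rwa [← φ.injective hzX]
  have hdeg := RatFunc.finrank_eq_max_natDegree f
  rw [hf, IntermediateField.finrank_top] at hdeg
  obtain ⟨b, a, hnum⟩ : ∃ b a : F, f.num = Polynomial.C a * Polynomial.X + Polynomial.C b :=
    ⟨_, _, Polynomial.eq_X_add_C_of_natDegree_le_one (by omega)⟩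
  obtain ⟨d, c, hden⟩ : ∃ b a : F, f.denom = Polynomial.C a * Polynomial.X + Polynomial.C b :=
    ⟨_, _, Polynomial.eq_X_add_C_of_natDegree_le_one (by omega)⟩
  have hden0 : Polynomial.aeval x f.denom ≠ 0 := fun h =>
    f.denom_ne_zero ((transcendental_iff.mp hx) _ h)
  have hyeq : y = Polynomial.aeval x f.num / Polynomial.aeval x f.denom := by
    rw [← RatFunc.algEquivOfTranscendental_apply x hx f]
    exact hφf.symm
  rw [eq_div_iff hden0] at hyeq
  have hnum' : Polynomial.aeval x f.num = algebraMap F E a * x + algebraMap F E b := by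
    rw [hnum]; simp
  have hden' : Polynomial.aeval x f.denom = algebraMap F E c * x + algebraMap F E d := by
    rw [hden]; simp
  rw [hden'] at hden0
  rw [hnum', hden'] at hyeq
  refine ⟨a, b, c, d, fun hdet => ?_, hden0, hyeq⟩
  have hdet' : algebraMap F E a * algebraMap F E d - algebraMap F E b * algebraMap F E c = 0 := by
    rw [← map_mul, ← map_mul, ← map_sub, hdet, map_zero]
  have hc : algebraMap F E c * y = algebraMap F E a := by
    apply mul_right_cancel₀ hden0
    linear_combination algebraMap F E c * hyeq - hdet'
  have hd : algebraMap F E d * y = algebraMap F E b := by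
    apply mul_right_cancel₀ hden0
    linear_combination algebraMap F E d * hyeq + x * hdet'
  have hyF : y ∈ (⊥ : IntermediateField F E) := by
    rw [IntermediateField.mem_bot]
    rcases eq_or_ne c 0 with rfl | hc0
    · have hd0 : algebraMap F E d ≠ 0 := by simpa using hden0
      exact ⟨b / d, by rw [map_div₀, ← hd]; field_simp⟩
    · have hc0' : algebraMap F E c ≠ 0 := by simpa using hc0
      exact ⟨a / c, by rw [map_div₀, ← hc]; field_simp⟩
  have hbot : (⊥ : IntermediateField F E) = ⊤ := by
    rw [← hyt, eq_comm, IntermediateField.adjoin_simple_eq_bot_iff]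
    exact hyF
  have hxF : x ∈ (⊥ : IntermediateField F E) := hbot ▸ IntermediateField.mem_top
  obtain ⟨z, rfl⟩ := IntermediateField.mem_bot.mp hxF
  exact hx (isAlgebraic_algebraMap z)

namespace Pt

variable {S : Set Cremona2} {s t : K2}

lemma exists_eq_div (h : Pt S s t) (z : K2) :
    ∃ P Q : MvPolynomial (Fin 2) ℂ, Q ≠ 0 ∧ z = ev s t P / ev s t Q := by
  obtain ⟨ψ, -, rfl, rfl⟩ := h
  obtain ⟨P, Q, hQ, hz⟩ := PlaneCremona.exists_eq_div (ψ.symm z)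
  refine ⟨P, Q, hQ, ?_⟩
  rw [← map_ev, ← map_ev, ← map_div₀, ← hz, AlgEquiv.apply_symm_apply]

lemma adjoin_eq_top (h : Pt S s t) :
    IntermediateField.adjoin (IntermediateField.adjoin ℂ {s}) {t} = ⊤ := by
  rw [eq_top_iff]
  rintro z -
  have key : ∀ P, ev s t P ∈ IntermediateField.adjoin (IntermediateField.adjoin ℂ {s}) {t} := by
    intro P
    rw [ev_eq_sum]
    refine sum_mem fun d _ => mul_mem ?_ (mul_mem (pow_mem ?_ _) (pow_mem ?_ _))
    · exact IntermediateField.algebraMap_mem _ (algebraMap ℂ _ (P.coeff d))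
    · exact IntermediateField.algebraMap_mem _
        (⟨s, IntermediateField.mem_adjoin_simple_self ℂ s⟩ : IntermediateField.adjoin ℂ {s})
    · exact IntermediateField.mem_adjoin_simple_self _ t
  obtain ⟨P, Q, -, rfl⟩ := h.exists_eq_div z
  exact div_mem (key P) (key Q)

lemma transcendental (h : Pt S s t) : Transcendental (IntermediateField.adjoin ℂ {s}) t := by
  rw [IntermediateField.transcendental_adjoin_iff]
  have h1 : AlgebraicIndependent ℂ ![s, t] := h.injective
  have h2 := h1.transcendental_adjoin (s := {0}) (i := 1) (by simp)
  have h3 : ![s, t] '' {0} = {s} := Set.image_singleton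
  rwa [h3] at h2

/-- An element of `S` fixing `x` yields the identity element in `S`. -/
lemma mem_of_left_eq {ψ : Cremona2} (hS : RightStable S) (h1 : (1 : Cremona2) ∈ S)
    (h : ψ X0 = X0) : ψ ∈ S := by
  have hP : Pt S X0 X1 := ⟨1, h1, rfl, rfl⟩
  have hP' : Pt Set.univ X0 (ψ X1) := ⟨ψ, Set.mem_univ _, h, rfl⟩
  obtain ⟨a, b, c, d, hdet, hcd, he⟩ :=
    exists_moebius_of_adjoin_eq_top hP.transcendental hP.adjoin_eq_top hP'.adjoin_eq_top
  obtain ⟨g, hg, hg0, hg1⟩ := hP.moebius hS a.2 b.2 c.2 d.2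
    (fun h0 => hdet (Subtype.ext h0)) hcd he
  rwa [cremona_ext (f := ψ) (g := g) (by rw [h, hg0]) hg1.symm]

end Pt

/-- The space of values at `(s, t)` of the polynomials all of whose monomials `X ^ i * Y ^ j`
satisfy `T i j`. -/
def PolyIn (T : ℕ → ℕ → Prop) (s t : K2) : Submodule ℂ K2 :=
  (restrictSupport ℂ {d : Fin 2 →₀ ℕ | T (d 0) (d 1)}).map (ev s t).toLinearMap

lemma mem_polyIn {T : ℕ → ℕ → Prop} {s t F : K2} :
    F ∈ PolyIn T s t ↔ ∃ P : MvPolynomial (Fin 2) ℂ, (∀ d ∈ P.support, T (d 0) (d 1)) ∧ ev s t P = F :=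
  Iff.rfl

lemma monomial_mem_polyIn {T : ℕ → ℕ → Prop} {i j : ℕ} (h : T i j) (s t : K2) :
    s ^ i * t ^ j ∈ PolyIn T s t := by
  refine mem_polyIn.mpr ⟨monomial (expo i j) 1, fun d hd => ?_, by simp [ev_monomial]⟩
  rw [Finset.mem_singleton.mp (support_monomial_subset hd)]
  simpa using h

lemma mul_mem_polyIn {T T' : ℕ → ℕ → Prop} {s t s' t' κ F : K2} (hF : F ∈ PolyIn T s t)
    (h : ∀ i j, T i j → κ * (s ^ i * t ^ j) ∈ PolyIn T' s' t') : κ * F ∈ PolyIn T' s' t' := by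
  obtain ⟨P, hP, rfl⟩ := mem_polyIn.mp hF
  rw [ev_eq_sum, Finset.mul_sum]
  refine Submodule.sum_mem _ fun d hd => ?_
  rw [mul_left_comm, ← Algebra.smul_def]
  exact Submodule.smul_mem _ _ (h _ _ (hP d hd))

lemma map_mem_polyIn {T : ℕ → ℕ → Prop} {s t F : K2} (f : Cremona2) (hF : F ∈ PolyIn T s t) :
    f F ∈ PolyIn T (f s) (f t) := by
  obtain ⟨P, hP, rfl⟩ := mem_polyIn.mp hF
  exact mem_polyIn.mpr ⟨P, hP, (map_ev f s t P).symm⟩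

/-- The pair `(s, t)` is the image of `(x, y)` under an element of `S`, and both `q` and `x * q`
are polynomials in `(s, t)` with all exponents in `T`. -/
structure Tup (S : Set Cremona2) (s t : K2) (T : ℕ → ℕ → Prop) (q : K2) : Prop where
  pt : Pt S s t
  ne_zero : q ≠ 0
  mem : q ∈ PolyIn T s t
  mul_mem : X0 * q ∈ PolyIn T s t

/-- The exponents in a trapezoid. -/
def Trap (n : ℤ) (a : ℕ) (b : ℤ) (i j : ℕ) : Prop := j ≤ a ∧ (i : ℤ) + n * j ≤ b

namespace Tup

variable {S : Set Cremona2} {s t q : K2} {T : ℕ → ℕ → Prop} {n b : ℤ} {a : ℕ}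

lemma map (h : Tup S s t T q) {T' : ℕ → ℕ → Prop} {s' t' κ : K2} (hp : Pt S s' t') (hκ : κ ≠ 0)
    (hT : ∀ i j, T i j → κ * (s ^ i * t ^ j) ∈ PolyIn T' s' t') : Tup S s' t' T' (κ * q) where
  pt := hp
  ne_zero := mul_ne_zero hκ h.ne_zero
  mem := mul_mem_polyIn h.mem hT
  mul_mem := by
    rw [mul_left_comm]
    exact mul_mem_polyIn h.mul_mem hT

lemma map_exponents (h : Tup S s t T q) {T' : ℕ → ℕ → Prop} {s' t' κ : K2} (hp : Pt S s' t')
    (hκ : κ ≠ 0)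
    (hT : ∀ i j, T i j → ∃ i' j', T' i' j' ∧ s' ^ i' * t' ^ j' = κ * (s ^ i * t ^ j)) :
    Tup S s' t' T' (κ * q) :=
  h.map hp hκ fun i j hij => by
    obtain ⟨i', j', h', he⟩ := hT i j hij
    rw [← he]
    exact monomial_mem_polyIn h' _ _

lemma mono (h : Tup S s t T q) {T' : ℕ → ℕ → Prop} (hT : ∀ i j, T i j → T' i j) :
    Tup S s t T' q := by
  simpa using h.map_exponents h.pt one_ne_zero
    fun i j hij => ⟨i, j, hT i j hij, by simp⟩

lemma inv_right (hS : RightStable S) (h : Tup S s t (Trap n a b) q) :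
    Tup S s t⁻¹ (Trap (-n) a (b - n * a)) ((t ^ a)⁻¹ * q) := by
  have ht := h.pt.right_ne_zero
  refine h.map_exponents (h.pt.inv_right hS) (inv_ne_zero (pow_ne_zero _ ht)) ?_
  rintro i j ⟨hj, hij⟩
  obtain ⟨k, rfl⟩ := Nat.exists_eq_add_of_le hj
  refine ⟨i, k, ⟨by omega, ?_⟩, ?_⟩
  · push_cast
    linarith
  · rw [pow_add, inv_pow]
    field_simp

lemma inv_left_eq {F : Type*} [Field F] {s : F} (t : F) (hs : s ≠ 0) {i j k : ℕ} {n b : ℤ}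
    (hk : (k : ℤ) = b - i - n * j) :
    s⁻¹ ^ k * (t * s ^ (-n)) ^ j = s ^ (-b) * (s ^ i * t ^ j) := by
  have h1 : s⁻¹ ^ k = s ^ (-(b - i - n * j)) := by
    rw [← hk, zpow_neg, zpow_natCast, inv_pow]
  have h2 : (s ^ (-n)) ^ j = s ^ (-n * j) := by rw [zpow_mul, zpow_natCast]
  rw [h1, mul_pow, h2, ← zpow_natCast s i]
  have h3 : s ^ (-(b - i - n * j)) * s ^ (-n * j) = s ^ (-b) * s ^ (i : ℤ) := by
    rw [← zpow_add₀ hs, ← zpow_add₀ hs]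
    congr 1
    ring
  linear_combination t ^ j * h3

lemma inv_left (hS : RightStable S) (h : Tup S s t (Trap n a b) q) :
    Tup S s⁻¹ (t * s ^ (-n)) (Trap n a b) (s ^ (-b) * q) := by
  have hs := h.pt.left_ne_zero
  refine h.map_exponents ((h.pt.mul_zpow hS (-n)).inv_left hS) (zpow_ne_zero _ hs) ?_
  rintro i j ⟨hj, hij⟩
  obtain ⟨k, hk⟩ := Int.eq_ofNat_of_zero_le (show 0 ≤ b - i - n * j by linarith)
  exact ⟨k, j, ⟨hj, by rw [← hk]; linarith⟩, inv_left_eq t hs hk.symm⟩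

lemma elementary (hS : RightStable S) {m : ℕ}
    (h : Tup S s t (fun i j => Trap n a b i j ∧ m ≤ i + j) q) :
    Tup S s (t * s⁻¹) (Trap (n - 1) a (b - m)) ((s ^ m)⁻¹ * q) := by
  have hs := h.pt.left_ne_zero
  have hp : Pt S s (t * s⁻¹) := by simpa using h.pt.mul_zpow hS (-1)
  refine h.map_exponents hp (inv_ne_zero (pow_ne_zero _ hs)) ?_
  rintro i j ⟨⟨hj, hij⟩, hm⟩
  obtain ⟨k, hk⟩ := Nat.exists_eq_add_of_le hm
  have hk' : (i : ℤ) + j = m + k := by exact_mod_cast hk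
  refine ⟨k, j, ⟨hj, by linarith⟩, ?_⟩
  rw [mul_pow, inv_pow]
  field_simp
  have h3 : s ^ k * s ^ m = s ^ j * s ^ i := by
    rw [← pow_add, ← pow_add, add_comm k, ← hk, add_comm i]
  linear_combination t ^ j * h3

lemma swap (hS : RightStable S) (h : Tup S s t T q) : Tup S t s (fun i j => T j i) q := by
  simpa using h.map_exponents (h.pt.swap hS) one_ne_zero
    fun i j hij => ⟨j, i, hij, by rw [one_mul, mul_comm]⟩

lemma add_left (hS : RightStable S) (h : Tup S s t T q) (c : ℂ)
    (hT : ∀ i i' j, i' ≤ i → T i j → T i' j) : Tup S (s + algebraMap ℂ K2 c) t T q := by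
  have := h.map (T' := T) (h.pt.add_left hS c) one_ne_zero fun i j hij => by
    have h1 : s ^ i * t ^ j = ((s + algebraMap ℂ K2 c) + algebraMap ℂ K2 (-c)) ^ i * t ^ j := by
      rw [map_neg, add_neg_cancel_right]
    rw [one_mul, h1, add_pow, Finset.sum_mul]
    refine Submodule.sum_mem _ fun k hk => ?_
    have h2 := monomial_mem_polyIn (hT i k j (Nat.lt_succ_iff.mp (Finset.mem_range.mp hk)) hij)
      (s + algebraMap ℂ K2 c) t
    convert Submodule.smul_mem _ ((-c) ^ (i - k) * (i.choose k : ℂ)) h2 using 1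
    rw [Algebra.smul_def, map_mul, map_pow, map_natCast]
    ring
  simpa using this

lemma add_right (hS : RightStable S) (h : Tup S s t T q) (c : ℂ)
    (hT : ∀ i j j', j' ≤ j → T i j → T i j') : Tup S s (t + algebraMap ℂ K2 c) T q :=
  ((h.swap hS).add_left hS c fun i i' j hi hij => hT j i i' hi hij).swap hS

end Tup

lemma Trap.left_le {n b : ℤ} {a : ℕ} (i i' j : ℕ) (hi : i' ≤ i) (h : Trap n a b i j) :
    Trap n a b i' j := ⟨h.1, by have := h.2; have : (i' : ℤ) ≤ i := by exact_mod_cast hi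
                                linarith⟩

lemma Trap.right_le {n b : ℤ} {a : ℕ} (hn : 0 ≤ n) (i j j' : ℕ) (hj : j' ≤ j)
    (h : Trap n a b i j) : Trap n a b i j' :=
  ⟨hj.trans h.1, by have := h.2; have : (j' : ℤ) ≤ j := by exact_mod_cast hj
                    nlinarith⟩

lemma exists_moebius_of_adjoin_eq {F E : Type*} [Field F] [Field E] [Algebra F E] {x y : E}
    (hx : Transcendental F x)
    (h : IntermediateField.adjoin F {y} = IntermediateField.adjoin F {x}) :
    ∃ a b c d : F, a * d - b * c ≠ 0 ∧ algebraMap F E c * x + algebraMap F E d ≠ 0 ∧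
      y * (algebraMap F E c * x + algebraMap F E d) = algebraMap F E a * x + algebraMap F E b := by
  let K := IntermediateField.adjoin F {x}
  have hxK : x ∈ K := IntermediateField.mem_adjoin_simple_self F x
  have hyK : y ∈ K := h.le (IntermediateField.mem_adjoin_simple_self F y)
  have htop : ∀ z : K, IntermediateField.adjoin F {(z : E)} = K →
      IntermediateField.adjoin F {z} = ⊤ := by
    intro z hz
    apply IntermediateField.lift_injective K
    rw [IntermediateField.lift_adjoin_simple, IntermediateField.lift_top, hz]
  have hx' : Transcendental F (⟨x, hxK⟩ : K) := fun halg =>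
    hx (halg.algHom K.val)
  obtain ⟨a, b, c, d, hdet, hcd, he⟩ := exists_moebius_of_adjoin_eq_top hx' (htop ⟨x, hxK⟩ rfl)
    (htop ⟨y, hyK⟩ h)
  exact ⟨a, b, c, d, hdet, fun h0 => hcd (Subtype.ext h0), congrArg Subtype.val he⟩

/-- A field is algebraically closed in its simple transcendental extensions. -/
lemma mem_bot_of_isAlgebraic {F E : Type*} [Field F] [Field E] [Algebra F E] {x z : E}
    (hx : Transcendental F x) (hxt : IntermediateField.adjoin F {x} = ⊤) (hz : IsAlgebraic F z) :
    z ∈ (⊥ : IntermediateField F E) := by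
  let e := RatFunc.algEquivOfTranscendental x hx
  have hzx : z ∈ IntermediateField.adjoin F {x} := hxt ▸ IntermediateField.mem_top
  let f := e.symm ⟨z, hzx⟩
  have hef : (e f : E) = z := by simp [f]
  by_cases hf : ∃ c, f = RatFunc.C c
  · obtain ⟨c, hc⟩ := hf
    rw [IntermediateField.mem_bot]
    refine ⟨c, ?_⟩
    rw [← hef, hc, ← RatFunc.algebraMap_eq_C, AlgEquiv.commutes]
    rfl
  · refine absurd ?_ (RatFunc.transcendental_of_ne_C f hf)
    let φ : RatFunc F →ₐ[F] E := (IntermediateField.adjoin F {x}).val.comp e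
    have hφ : IsAlgebraic F (φ f) := by rwa [← hef] at hz
    exact (isAlgebraic_algHom_iff φ (RingHom.injective _)).mp hφ

namespace Pt

variable {S : Set Cremona2} {s t : K2}

/-- If `x` is a rational function of `s`, then `s` can be replaced by `x`. -/
lemma of_X0_mem_adjoin (hS : RightStable S) (h : Pt S s t)
    (hX : X0 ∈ IntermediateField.adjoin ℂ {s}) : Pt S X0 t := by
  have h01 : Pt Set.univ X0 X1 := ⟨1, Set.mem_univ _, rfl, rfl⟩
  have hs : s ∈ IntermediateField.adjoin ℂ {X0} := by
    obtain ⟨P, Q, hPQ⟩ := (IntermediateField.mem_adjoin_simple_iff ℂ X0).mp hX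
    have hQs : Polynomial.aeval s Q ≠ 0 := by
      intro h0
      rw [h0, div_zero] at hPQ
      exact X0_ne_zero hPQ
    rw [eq_div_iff hQs] at hPQ
    have halg : IsAlgebraic (IntermediateField.adjoin ℂ {X0}) s := by
      refine ⟨Polynomial.C (IntermediateField.AdjoinSimple.gen ℂ X0) * Q.map (algebraMap ℂ _) -
        P.map (algebraMap ℂ _), fun h0 => ?_, ?_⟩
      · obtain ⟨i, hi⟩ : ∃ i, Q.coeff i ≠ 0 := by
          by_contra! hQ
          exact hQs (by rw [Polynomial.ext (q := 0) hQ, map_zero])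
        have h1 := congrArg (fun p => ((p.coeff i : IntermediateField.adjoin ℂ {X0}) : K2)) h0
        have h2 : X0 * algebraMap ℂ K2 (Q.coeff i) - algebraMap ℂ K2 (P.coeff i) = 0 := by
          simpa using h1
        refine h01.left_add_ne_zero (-(P.coeff i / Q.coeff i)) ?_
        have h3 : algebraMap ℂ K2 (Q.coeff i) ≠ 0 := by simpa using hi
        rw [map_neg, map_div₀, ← sub_eq_add_neg, sub_eq_zero, eq_div_iff h3]
        exact sub_eq_zero.mp h2
      · simp [Polynomial.aeval_map_algebraMap, hPQ]
    have h1 := mem_bot_of_isAlgebraic h01.transcendental h01.adjoin_eq_top halg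
    obtain ⟨z, hz⟩ := IntermediateField.mem_bot.mp h1
    rw [← hz]
    exact z.2
  have hst : Transcendental ℂ s := by
    have h1 : AlgebraicIndependent ℂ ![s, t] := h.injective
    exact h1.transcendental 0
  obtain ⟨a, b, c, d, hdet, hcd, he⟩ := exists_moebius_of_adjoin_eq (x := s) (y := X0) hst
    (le_antisymm (IntermediateField.adjoin_simple_le_iff.mpr hX)
      (IntermediateField.adjoin_simple_le_iff.mpr hs))
  refine (((h.swap hS).moebius hS (algebraMap_mem _ a) (algebraMap_mem _ b) (algebraMap_mem _ c)
    (algebraMap_mem _ d) ?_ hcd he)).swap hS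
  rwa [← map_mul, ← map_mul, ← map_sub, ne_eq, map_eq_zero]

end Pt

lemma mem_adjoin_of_mem_polyIn {s t F : K2} {n b : ℤ} (h : F ∈ PolyIn (Trap n 0 b) s t) :
    F ∈ IntermediateField.adjoin ℂ {s} := by
  obtain ⟨P, hP, rfl⟩ := mem_polyIn.mp h
  rw [ev_eq_sum]
  refine sum_mem fun d hd => ?_
  rw [Nat.le_zero.mp (hP d hd).1, pow_zero, mul_one]
  exact mul_mem (algebraMap_mem _ _)
    (pow_mem (IntermediateField.mem_adjoin_simple_self ℂ s) _)

lemma Tup.pt_X0 {S : Set Cremona2} {s t q : K2} {n b : ℤ} (hS : RightStable S)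
    (h : Tup S s t (Trap n 0 b) q) : Pt S X0 t := by
  refine h.pt.of_X0_mem_adjoin hS ?_
  have h1 := div_mem (mem_adjoin_of_mem_polyIn h.mul_mem) (mem_adjoin_of_mem_polyIn h.mem)
  rwa [mul_div_cancel_right₀ _ h.ne_zero] at h1

/-- Exponents are bounded, so that any pair of polynomials gives rise to some trapezoid. -/
lemma Tup.of_polynomials {S : Set Cremona2} {s t : K2} (h : Pt S s t)
    {P Q : MvPolynomial (Fin 2) ℂ} (hQ : Q ≠ 0) (hPQ : ev s t P = X0 * ev s t Q) {a : ℕ}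
    (hP1 : P.degreeOf 1 ≤ a) (hQ1 : Q.degreeOf 1 ≤ a) :
    ∃ b : ℤ, Tup S s t (Trap 0 a b) (ev s t Q) := by
  refine ⟨max (P.degreeOf 0) (Q.degreeOf 0), h, h.ev_ne_zero hQ, ?_, ?_⟩
  · refine mem_polyIn.mpr ⟨Q, fun d hd => ⟨(degreeOf_le_iff.mp hQ1) d hd, ?_⟩, rfl⟩
    have := degreeOf_le_iff.mp (le_refl (degreeOf 0 _)) d hd
    simp
    omega
  · refine mem_polyIn.mpr ⟨P, fun d hd => ⟨(degreeOf_le_iff.mp hP1) d hd, ?_⟩, hPQ⟩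
    have := degreeOf_le_iff.mp (le_refl (degreeOf 0 _)) d hd
    simp
    omega

lemma Pt.exists_tup {S : Set Cremona2} {s t : K2} (h : Pt S s t) :
    ∃ (a : ℕ) (b : ℤ) (q : K2), Tup S s t (Trap 0 a b) q := by
  obtain ⟨P, Q, hQ, hPQ⟩ := h.exists_eq_div X0
  rw [eq_div_iff (h.ev_ne_zero hQ)] at hPQ
  obtain ⟨b, hb⟩ := Tup.of_polynomials h hQ hPQ.symm (a := max (P.degreeOf 1) (Q.degreeOf 1))
    (le_max_left _ _) (le_max_right _ _)
  exact ⟨_, b, _, hb⟩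

lemma derivation_ev (D : Derivation ℂ K2 K2) (s t : K2) (P : MvPolynomial (Fin 2) ℂ) :
    D (ev s t P) = ev s t (pderiv 0 P) * D s + ev s t (pderiv 1 P) * D t := by
  induction P using MvPolynomial.induction_on with
  | C c => simp
  | add P Q hP hQ =>
    simp only [map_add, hP, hQ]
    ring
  | mul_X P i hP =>
    rw [map_mul, D.leibniz, hP]
    fin_cases i
    · simp [pderiv_X]
      ring
    · simp [pderiv_X]
      ring

/-- The lift of the universal first-order deformation of the inclusion `ℂ[x, y] → ℂ(x, y)`. -/
def deformation (u w : K2) : MvPolynomial (Fin 2) ℂ →ₐ[ℂ] TrivSqZeroExt K2 K2 :=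
  aeval ![TrivSqZeroExt.inl X0 + TrivSqZeroExt.inr u, TrivSqZeroExt.inl X1 + TrivSqZeroExt.inr w]

lemma fst_deformation (u w : K2) (P : MvPolynomial (Fin 2) ℂ) :
    (deformation u w P).fst = algebraMap _ K2 P := by
  have h : (TrivSqZeroExt.fstHom ℂ K2 K2).comp (deformation u w) = ev X0 X1 := by
    refine algHom_ext fun i => ?_
    fin_cases i <;> simp [deformation]
  rw [← ev_X0_X1, ← h]
  rfl

lemma exists_derivation (u w : K2) : ∃ D : Derivation ℂ K2 K2, D X0 = u ∧ D X1 = w := by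
  have hunit : ∀ y : nonZeroDivisors (MvPolynomial (Fin 2) ℂ), IsUnit (deformation u w y) := by
    intro y
    rw [TrivSqZeroExt.isUnit_iff_isUnit_fst, fst_deformation, isUnit_iff_ne_zero]
    exact IsFractionRing.to_map_ne_zero_of_mem_nonZeroDivisors y.2
  let φ : K2 →ₐ[ℂ] TrivSqZeroExt K2 K2 := IsLocalization.liftAlgHom hunit
  have hφ : ∀ P, φ (algebraMap _ K2 P) = deformation u w P := fun P =>
    IsLocalization.lift_eq _ P
  have hfst : ∀ z, (φ z).fst = z := by
    intro z
    have h : (TrivSqZeroExt.fstHom ℂ K2 K2).comp φ = AlgHom.id ℂ K2 := by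
      refine hom_ext_K2 ?_ ?_
      · simp [X0, hφ, fst_deformation]
      · simp [X1, hφ, fst_deformation]
    exact DFunLike.congr_fun h z
  let D : Derivation ℂ K2 K2 := Derivation.mk'
    { toFun := fun z => (φ z).snd
      map_add' := fun y z => by rw [map_add, TrivSqZeroExt.snd_add]
      map_smul' := fun c z => by rw [map_smul, TrivSqZeroExt.snd_smul]; rfl }
    (fun y z => by
      change (φ (y * z)).snd = y * (φ z).snd + z * (φ y).snd
      rw [map_mul, TrivSqZeroExt.snd_mul, hfst, hfst, smul_eq_mul, op_smul_eq_smul, smul_eq_mul])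
  refine ⟨D, ?_, ?_⟩
  · change (φ (algebraMap _ K2 (X 0))).snd = u
    rw [hφ]
    simp [deformation]
  · change (φ (algebraMap _ K2 (X 1))).snd = w
    rw [hφ]
    simp [deformation]

/-- The partial derivatives of rational functions. -/
def dd (i : Fin 2) : Derivation ℂ K2 K2 :=
  (exists_derivation (if i = 0 then 1 else 0) (if i = 1 then 1 else 0)).choose

lemma dd_X0 (i : Fin 2) : dd i X0 = if i = 0 then 1 else 0 :=
  (exists_derivation (if i = 0 then 1 else 0) (if i = 1 then 1 else 0)).choose_spec.1

lemma dd_X1 (i : Fin 2) : dd i X1 = if i = 1 then 1 else 0 :=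
  (exists_derivation (if i = 0 then 1 else 0) (if i = 1 then 1 else 0)).choose_spec.2

lemma dd_ev (i : Fin 2) (P : MvPolynomial (Fin 2) ℂ) :
    dd i (ev X0 X1 P) = ev X0 X1 (pderiv i P) := by
  rw [derivation_ev, dd_X0, dd_X1]
  fin_cases i <;> simp

/-- The derivation `g ↦ Jac(f, g)`, the Jacobian determinant with respect to `x` and `y`. -/
def jac (f : K2) : Derivation ℂ K2 K2 := dd 0 f • dd 1 - dd 1 f • dd 0

lemma jac_apply (f g : K2) : jac f g = dd 0 f * dd 1 g - dd 1 f * dd 0 g := by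
  simp [jac]

lemma jac_comm (f g : K2) : jac g f = -jac f g := by
  rw [jac_apply, jac_apply]
  ring

lemma jac_self (f : K2) : jac f f = 0 := by
  rw [jac_apply]
  ring

lemma jac_ev_right (s t : K2) (P : MvPolynomial (Fin 2) ℂ) :
    jac s (ev s t P) = ev s t (pderiv 1 P) * jac s t := by
  rw [derivation_ev, jac_self, mul_zero, zero_add]

lemma jac_ev_left (s t : K2) (P : MvPolynomial (Fin 2) ℂ) :
    jac t (ev s t P) = -(ev s t (pderiv 0 P) * jac s t) := by
  rw [derivation_ev, jac_self, jac_comm s t, mul_zero, add_zero, mul_neg]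

lemma Pt.derivation_eq_zero {S : Set Cremona2} {s t : K2} (h : Pt S s t) {D : Derivation ℂ K2 K2}
    (hs : D s = 0) (ht : D t = 0) (z : K2) : D z = 0 := by
  obtain ⟨P, Q, -, rfl⟩ := h.exists_eq_div z
  rw [D.leibniz_div, derivation_ev, derivation_ev, hs, ht]
  simp

lemma Pt.jac_ne_zero {S : Set Cremona2} {s t : K2} (h : Pt S s t) : jac s t ≠ 0 := by
  intro h0
  have h1 : ∀ z, jac s z = 0 := h.derivation_eq_zero (jac_self s) h0
  have h2 : ∀ z, jac t z = 0 := h.derivation_eq_zero (by rw [jac_comm, h0, neg_zero]) (jac_self t)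
  have key : ∀ f, (∀ z, jac f z = 0) → dd 0 f = 0 := by
    intro f hf
    have := hf X1
    simpa [jac_apply, dd_X1] using this
  have h3 := h.derivation_eq_zero (key s h1) (key t h2) X0
  rw [dd_X0] at h3
  simp at h3

/-- The rational functions that are regular at the generic point of the curve `p = 0`. -/
def regularAt {p : MvPolynomial (Fin 2) ℂ} (hp : Prime p) : ValuationSubring K2 where
  carrier := {f | ∃ α β : MvPolynomial (Fin 2) ℂ, ¬p ∣ β ∧ f = ev X0 X1 α / ev X0 X1 β}
  mul_mem' := by
    rintro _ _ ⟨α, β, hβ, rfl⟩ ⟨α', β', hβ', rfl⟩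
    refine ⟨α * α', β * β', hp.not_dvd_mul hβ hβ', ?_⟩
    rw [map_mul, map_mul, div_mul_div_comm]
  one_mem' := ⟨1, 1, hp.not_dvd_one, by simp⟩
  add_mem' := by
    rintro _ _ ⟨α, β, hβ, rfl⟩ ⟨α', β', hβ', rfl⟩
    refine ⟨α * β' + β * α', β * β', hp.not_dvd_mul hβ hβ', ?_⟩
    have h1 := ev_X0_X1_ne_zero (P := β) fun h => hβ (h ▸ dvd_zero p)
    have h2 := ev_X0_X1_ne_zero (P := β') fun h => hβ' (h ▸ dvd_zero p)
    simp only [map_mul, map_add]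
    rw [div_add_div _ _ h1 h2]
  zero_mem' := ⟨0, 1, hp.not_dvd_one, by simp⟩
  neg_mem' := by
    rintro _ ⟨α, β, hβ, rfl⟩
    exact ⟨-α, β, hβ, by rw [map_neg]; ring⟩
  mem_or_inv_mem' := by
    intro f
    have hf : f = ev X0 X1 (IsFractionRing.num (MvPolynomial (Fin 2) ℂ) f) /
        ev X0 X1 (IsFractionRing.den (MvPolynomial (Fin 2) ℂ) f) := by
      rw [ev_X0_X1, ev_X0_X1, ← IsFractionRing.mk'_num_den' (MvPolynomial (Fin 2) ℂ) f]
      simp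
    by_cases h : p ∣ (IsFractionRing.den (MvPolynomial (Fin 2) ℂ) f : MvPolynomial (Fin 2) ℂ)
    · right
      refine ⟨_, _, fun h' => ?_, by rw [← inv_div, ← hf]⟩
      exact hp.not_isUnit (IsFractionRing.num_den_reduced (MvPolynomial (Fin 2) ℂ) f h' h)
    · exact Or.inl ⟨_, _, h, hf⟩

/-- The valuation of `ℂ(x, y)` attached to the curve `p = 0`. -/
abbrev ord {p : MvPolynomial (Fin 2) ℂ} (hp : Prime p) : Valuation K2 (regularAt hp).ValueGroup :=
  (regularAt hp).valuation

section

variable {p : MvPolynomial (Fin 2) ℂ} (hp : Prime p)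

lemma ord_le_one_iff (f : K2) : ord hp f ≤ 1 ↔
    ∃ α β : MvPolynomial (Fin 2) ℂ, ¬p ∣ β ∧ f = ev X0 X1 α / ev X0 X1 β :=
  ValuationSubring.valuation_le_one_iff _ f

lemma ord_ev_le_one (P : MvPolynomial (Fin 2) ℂ) : ord hp (ev X0 X1 P) ≤ 1 :=
  (ord_le_one_iff hp _).mpr ⟨P, 1, hp.not_dvd_one, by simp⟩

lemma ord_ev_eq_one {P : MvPolynomial (Fin 2) ℂ} (h : ¬p ∣ P) : ord hp (ev X0 X1 P) = 1 := by
  refine le_antisymm (ord_ev_le_one hp P) ?_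
  have h1 : ord hp (ev X0 X1 P)⁻¹ ≤ 1 := (ord_le_one_iff hp _).mpr ⟨1, P, h, by simp⟩
  have h2 : ev X0 X1 P ≠ 0 := ev_X0_X1_ne_zero fun h0 => h (h0 ▸ dvd_zero p)
  rw [map_inv₀] at h1
  exact (inv_le_one₀ (zero_lt_iff.mpr ((ord hp).ne_zero_iff.mpr h2))).mp h1

lemma ord_self_lt_one : ord hp (ev X0 X1 p) < 1 := by
  refine lt_of_le_of_ne (ord_ev_le_one hp p) fun h => ?_
  have h1 : ord hp (ev X0 X1 p)⁻¹ ≤ 1 := by rw [map_inv₀, h, inv_one]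
  obtain ⟨α, β, hβ, he⟩ := (ord_le_one_iff hp _).mp h1
  have hp0 := ev_X0_X1_ne_zero hp.ne_zero
  have hβ0 := ev_X0_X1_ne_zero (P := β) fun h0 => hβ (h0 ▸ dvd_zero p)
  rw [eq_div_iff hβ0, inv_mul_eq_iff_eq_mul₀ hp0, ← map_mul] at he
  exact hβ ⟨α, ev_X0_X1_injective he⟩

lemma ord_algebraMap {c : ℂ} (hc : c ≠ 0) : ord hp (algebraMap ℂ K2 c) = 1 := by
  rw [← ev_C X0 X1 c]
  refine ord_ev_eq_one hp fun h => hp.not_isUnit (isUnit_of_dvd_unit h ?_)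
  exact (isUnit_iff_ne_zero.mpr hc).map C

lemma exists_eq_pow_mul {P : MvPolynomial (Fin 2) ℂ} (hP : P ≠ 0) :
    ∃ (k : ℕ) (w : K2), ord hp w = 1 ∧ ev X0 X1 P = ev X0 X1 p ^ k * w := by
  obtain ⟨Q, hPQ, hQ⟩ := (FiniteMultiplicity.of_prime_left hp hP).exists_eq_pow_mul_and_not_dvd
  exact ⟨_, _, ord_ev_eq_one hp hQ, by conv_lhs => rw [hPQ, map_mul, map_pow]⟩

lemma exists_eq_zpow_mul {f : K2} (hf : f ≠ 0) :
    ∃ (k : ℤ) (w : K2), ord hp w = 1 ∧ f = ev X0 X1 p ^ k * w := by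
  obtain ⟨P, Q, hQ, rfl⟩ := exists_eq_div f
  have hP : P ≠ 0 := by
    rintro rfl
    simp at hf
  obtain ⟨k, w, hw, hk⟩ := exists_eq_pow_mul hp hP
  obtain ⟨l, u, hu, hl⟩ := exists_eq_pow_mul hp hQ
  refine ⟨k - l, w / u, by rw [map_div₀, hw, hu, div_one], ?_⟩
  rw [hk, hl, zpow_sub₀ (ev_X0_X1_ne_zero hp.ne_zero), zpow_natCast, zpow_natCast,
    mul_div_mul_comm]

lemma ord_dd_le_one (i : Fin 2) {f : K2} (hf : ord hp f ≤ 1) : ord hp (dd i f) ≤ 1 := by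
  obtain ⟨α, β, hβ, rfl⟩ := (ord_le_one_iff hp f).mp hf
  have h0 := ord_ev_eq_one hp hβ
  rw [Derivation.leibniz_div, dd_ev, dd_ev, smul_eq_mul, smul_eq_mul, smul_eq_mul, ← map_mul,
    ← map_mul, ← map_sub, map_mul, map_pow, map_inv₀, h0, inv_one, one_pow, one_mul]
  exact ord_ev_le_one hp _

lemma ord_jac_le_one {f g : K2} (hf : ord hp f ≤ 1) (hg : ord hp g ≤ 1) :
    ord hp (jac f g) ≤ 1 := by
  rw [jac_apply]
  refine (Valuation.map_sub _ _ _).trans (max_le ?_ ?_) <;> rw [map_mul] <;>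
    exact mul_le_one' (ord_dd_le_one hp _ ‹_›) (ord_dd_le_one hp _ ‹_›)

lemma ord_jac_le {f : K2} (hf : ord hp f < 1) (g : K2) : ord hp (jac f g) ≤ ord hp g := by
  set π := ev X0 X1 p with hπdef
  have hπ0 : π ≠ 0 := ev_X0_X1_ne_zero hp.ne_zero
  have hπ1 : ord hp π < 1 := ord_self_lt_one hp
  have hvπ : 0 < ord hp π := zero_lt_iff.mpr ((ord hp).ne_zero_iff.mpr hπ0)
  have hjπ : ord hp (jac f π) ≤ ord hp π := by
    rcases eq_or_ne f 0 with rfl | hf0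
    · simp [jac_apply]
    obtain ⟨k, w, hw, hk⟩ := exists_eq_zpow_mul hp hf0
    have hk1 : 1 ≤ k := by
      by_contra! hk0
      rw [hk, map_mul, hw, mul_one, map_zpow₀] at hf
      exact not_le_of_gt hf (one_le_zpow_of_nonpos₀ hvπ hπ1.le (by omega))
    have h1 : jac f π = -(π ^ k * jac π w) := by
      rw [jac_comm π f]
      conv_lhs => rw [hk]
      rw [Derivation.leibniz, Derivation.leibniz_zpow, jac_self, zsmul_eq_mul, smul_eq_mul,
        smul_eq_mul, smul_eq_mul]
      ring
    rw [h1, Valuation.map_neg, map_mul, map_zpow₀]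
    calc ord hp π ^ k * ord hp (jac π w) ≤ ord hp π ^ (1 : ℤ) * 1 :=
          mul_le_mul' (zpow_le_zpow_right_of_le_one₀ hvπ hπ1.le hk1)
            (ord_jac_le_one hp hπ1.le hw.le)
      _ = ord hp π := by rw [zpow_one, mul_one]
  rcases eq_or_ne g 0 with rfl | hg0
  · simp
  obtain ⟨l, u, hu, hl⟩ := exists_eq_zpow_mul hp hg0
  have hl' : ord hp g = ord hp π ^ l := by rw [hl, map_mul, map_zpow₀, hu, mul_one]
  rw [hl']
  conv_lhs => rw [hl]
  rw [Derivation.leibniz, Derivation.leibniz_zpow, smul_eq_mul, smul_eq_mul, zsmul_eq_mul,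
    smul_eq_mul]
  refine (Valuation.map_add _ _ _).trans (max_le ?_ ?_)
  · rw [map_mul, map_zpow₀]
    exact mul_le_of_le_one_right' (ord_jac_le_one hp hf.le hu.le)
  · have hint : ord hp (l : K2) ≤ 1 := by
      rw [← map_intCast (ev X0 X1)]
      exact ord_ev_le_one hp _
    rw [map_mul, hu, one_mul, map_mul, map_mul, map_zpow₀]
    calc ord hp (l : K2) * (ord hp π ^ (l - 1) * ord hp (jac f π))
        ≤ 1 * (ord hp π ^ (l - 1) * ord hp π) := mul_le_mul' hint (mul_le_mul' le_rfl hjπ)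
      _ = ord hp π ^ l := by rw [one_mul, ← zpow_add_one₀ hvπ.ne', sub_add_cancel]

end

section

variable {p : MvPolynomial (Fin 2) ℂ} (hp : Prime p)

lemma ord_algebraMap_le_one (c : ℂ) : ord hp (algebraMap ℂ K2 c) ≤ 1 := by
  rcases eq_or_ne c 0 with rfl | hc
  · simp
  · exact (ord_algebraMap hp hc).le

lemma ord_ev_le {s t : K2} (hs : ord hp s ≤ 1) (ht : ord hp t ≤ 1)
    (P : MvPolynomial (Fin 2) ℂ) : ord hp (ev s t P) ≤ 1 := by
  rw [ev_eq_sum]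
  refine Valuation.map_sum_le _ fun d _ => ?_
  rw [map_mul, map_mul, map_pow, map_pow]
  exact mul_le_one' (ord_algebraMap_le_one hp _)
    (mul_le_one' (pow_le_one' hs _) (pow_le_one' ht _))

lemma ord_ev_lt {s t : K2} (hs : ord hp s < 1) (ht : ord hp t < 1)
    {P : MvPolynomial (Fin 2) ℂ} (hP : P.coeff 0 = 0) : ord hp (ev s t P) < 1 := by
  rw [ev_eq_sum]
  refine Valuation.map_sum_lt _ one_ne_zero fun d hd => ?_
  rw [map_mul, map_mul, map_pow, map_pow]
  refine lt_of_le_of_lt (mul_le_of_le_one_left' (ord_algebraMap_le_one hp _)) ?_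
  rcases Nat.eq_zero_or_pos (d 0) with h0 | h0
  · rcases Nat.eq_zero_or_pos (d 1) with h1 | h1
    · refine absurd hP ?_
      have : d = 0 := by
        ext i
        fin_cases i <;> assumption
      rwa [this, mem_support_iff] at hd
    · rw [h0, pow_zero, one_mul]
      exact pow_lt_one₀ zero_le ht h1.ne'
  · exact lt_of_le_of_lt (mul_le_of_le_one_right' (pow_le_one' ht.le _))
      (pow_lt_one₀ zero_le hs h0.ne')

/-- A polynomial with a monomial of degree `k` vanishes at the image point to an order at most
`k` times the order of the Jacobian determinant. -/
lemma ord_jac_pow_le {s t : K2} (hs : ord hp s < 1) (ht : ord hp t < 1)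
    {P : MvPolynomial (Fin 2) ℂ} {d : Fin 2 →₀ ℕ} (hd : P.coeff d ≠ 0) :
    ord hp (jac s t) ^ (d 0 + d 1) ≤ ord hp (ev s t P) := by
  induction hk : d 0 + d 1 generalizing P d with
  | zero =>
    have hd0 : d = 0 := by
      ext i
      fin_cases i
      · exact (Nat.add_eq_zero_iff.mp hk).1
      · exact (Nat.add_eq_zero_iff.mp hk).2
    subst hd0
    have h1 : ord hp (ev s t (P - C (P.coeff 0))) < 1 := ord_ev_lt hp hs ht (by simp)
    have h2 : ord hp (algebraMap ℂ K2 (P.coeff 0)) = 1 := ord_algebraMap hp hd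
    have h3 : ev s t P = ev s t (P - C (P.coeff 0)) + algebraMap ℂ K2 (P.coeff 0) := by
      rw [map_sub, ev_C, sub_add_cancel]
    rw [h3, Valuation.map_add_eq_of_lt_right _ (by rw [h2]; exact h1), h2, pow_zero]
  | succ k ih =>
    have key : ∀ i, d i ≠ 0 → ord hp (jac s t) ^ k ≤ ord hp (ev s t (pderiv i P)) := by
      intro i hi
      have hd' : d - Finsupp.single i 1 + Finsupp.single i 1 = d := by
        refine tsub_add_cancel_of_le ?_
        rw [Finsupp.single_le_iff]
        omega
      refine ih (d := d - Finsupp.single i 1) ?_ ?_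
      · rw [coeff_pderiv, hd']
        refine mul_ne_zero hd ?_
        exact Nat.cast_add_one_ne_zero _
      · have h0 := DFunLike.congr_fun hd' 0
        have h1 := DFunLike.congr_fun hd' 1
        fin_cases i <;> simp at h0 h1 hi ⊢ <;> omega
    rcases Nat.eq_zero_or_pos (d 1) with h1 | h1
    · have h2 := ord_jac_le hp ht (ev s t P)
      rw [jac_ev_left, Valuation.map_neg, map_mul] at h2
      rw [pow_succ]
      exact (mul_le_mul' (key 0 (by omega)) le_rfl).trans h2
    · have h2 := ord_jac_le hp hs (ev s t P)
      rw [jac_ev_right, map_mul] at h2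
      rw [pow_succ]
      exact (mul_le_mul' (key 1 (by omega)) le_rfl).trans h2

/-- The polynomials vanishing along the image of the curve `p = 0` under `(s, t)`. -/
def centerIdeal {s t : K2} (hs : ord hp s ≤ 1) (ht : ord hp t ≤ 1) :
    Ideal (MvPolynomial (Fin 2) ℂ) where
  carrier := {P | ord hp (ev s t P) < 1}
  zero_mem' := by simp
  add_mem' hP hQ := by
    simp only [Set.mem_ofPred_eq, map_add] at *
    exact Valuation.map_add_lt _ hP hQ
  smul_mem' c P hP := by
    simp only [Set.mem_ofPred_eq, smul_eq_mul, map_mul] at *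
    exact lt_of_le_of_lt (mul_le_of_le_one_left' (ord_ev_le hp hs ht c)) hP

lemma mem_centerIdeal {s t : K2} (hs : ord hp s ≤ 1) (ht : ord hp t ≤ 1)
    {P : MvPolynomial (Fin 2) ℂ} : P ∈ centerIdeal hp hs ht ↔ ord hp (ev s t P) < 1 := Iff.rfl

lemma isPrime_centerIdeal {s t : K2} (hs : ord hp s ≤ 1) (ht : ord hp t ≤ 1) :
    (centerIdeal hp hs ht).IsPrime := by
  refine ⟨fun h => ?_, fun {P Q} h => ?_⟩
  · rw [Ideal.eq_top_iff_one, mem_centerIdeal, map_one, map_one] at h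
    exact h.ne rfl
  · simp only [mem_centerIdeal, map_mul] at h ⊢
    by_contra! h'
    exact not_le_of_gt h (one_le_mul h'.1 h'.2)

end

lemma isMaximal_of_lt {g : MvPolynomial (Fin 2) ℂ} (hg : Prime g)
    {I : Ideal (MvPolynomial (Fin 2) ℂ)} (hI : I.IsPrime) (h : Ideal.span {g} < I) :
    I.IsMaximal := by
  obtain ⟨M, hM, hIM⟩ := Ideal.exists_le_maximal I hI.ne_top
  rcases hIM.lt_or_eq with hlt | rfl
  swap
  · exact hM
  have hg' : (Ideal.span {g}).IsPrime := (Ideal.span_singleton_prime hg.ne_zero).mpr hg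
  let chain : LTSeries (PrimeSpectrum (MvPolynomial (Fin 2) ℂ)) :=
    { length := 3
      toFun := ![⟨⊥, Ideal.isPrime_bot⟩, ⟨_, hg'⟩, ⟨I, hI⟩, ⟨M, hM.isPrime⟩]
      step := by
        intro i
        fin_cases i
        · change (⊥ : Ideal (MvPolynomial (Fin 2) ℂ)) < Ideal.span {g}
          rw [bot_lt_iff_ne_bot, ne_eq, Ideal.span_singleton_eq_bot]
          exact hg.ne_zero
        · exact h
        · exact hlt }
  have h1 := Order.LTSeries.length_le_krullDim chain
  have h2 : ringKrullDim (MvPolynomial (Fin 2) ℂ) = 2 := by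
    rw [MvPolynomial.ringKrullDim_of_isNoetherianRing]
    simp
  change (3 : WithBot ℕ∞) ≤ ringKrullDim (MvPolynomial (Fin 2) ℂ) at h1
  rw [h2] at h1
  exact absurd h1 (by decide)

lemma exists_center {p : MvPolynomial (Fin 2) ℂ} (hp : Prime p) {s t : K2} (hs : ord hp s ≤ 1)
    (ht : ord hp t ≤ 1) {P Q : MvPolynomial (Fin 2) ℂ} (hQ0 : Q ≠ 0)
    (hP : ord hp (ev s t P) < 1) (hQ : ord hp (ev s t Q) < 1) :
    (∃ g, Prime g ∧ g ∣ P ∧ g ∣ Q) ∨ ∃ c e : ℂ, ord hp (s + algebraMap ℂ K2 c) < 1 ∧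
      ord hp (t + algebraMap ℂ K2 e) < 1 := by
  have hI := isPrime_centerIdeal hp hs ht
  have hI0 : centerIdeal hp hs ht ≠ ⊥ := fun h =>
    hQ0 ((Submodule.eq_bot_iff _).mp h Q hQ)
  obtain ⟨g, hgI, hg⟩ := Ideal.IsPrime.exists_mem_prime_of_ne_bot hI hI0
  by_cases h : g ∣ P ∧ g ∣ Q
  · exact Or.inl ⟨g, hg, h⟩
  right
  have hlt : Ideal.span {g} < centerIdeal hp hs ht := by
    refine lt_of_le_of_ne ((Ideal.span_singleton_le_iff_mem _).mpr hgI) fun he => h ?_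
    rw [← Ideal.mem_span_singleton, ← Ideal.mem_span_singleton, he]
    exact ⟨hP, hQ⟩
  obtain ⟨x, hx⟩ := isMaximal_iff_eq_vanishingIdeal_singleton.mp (isMaximal_of_lt hg hI hlt)
  have key : ∀ i, X i - C (x i) ∈ centerIdeal hp hs ht := by
    intro i
    rw [hx, mem_vanishingIdeal_singleton_iff]
    simp
  refine ⟨-x 0, -x 1, ?_, ?_⟩
  · have := (mem_centerIdeal hp hs ht).mp (key 0)
    rwa [map_sub, ev_X_zero, ev_C, sub_eq_add_neg, ← map_neg] at this
  · have := (mem_centerIdeal hp hs ht).mp (key 1)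
    rwa [map_sub, ev_X_one, ev_C, sub_eq_add_neg, ← map_neg] at this

lemma exists_dvd_pow {R : Type*} [CommRing R] [IsDomain R] [UniqueFactorizationMonoid R] {β x : R}
    (hβ : β ≠ 0) (h : ∀ p, Prime p → p ∣ β → p ∣ x) : ∃ e : ℕ, β ∣ x ^ e := by
  induction β using UniqueFactorizationMonoid.induction_on_prime with
  | h₁ => exact absurd rfl hβ
  | h₂ u hu => exact ⟨0, hu.dvd⟩
  | h₃ β p hβ0 hp ih =>
    obtain ⟨e, he⟩ := ih hβ0 fun q hq hqβ => h q hq (hqβ.mul_left p)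
    exact ⟨e + 1, by rw [pow_succ']; exact mul_dvd_mul (h p hp (dvd_mul_right p β)) he⟩

/-- A rational function that is regular away from `x = 0` is a polynomial over a power of `x`. -/
lemma exists_mul_X0_pow {θ : K2}
    (h : ∀ p : MvPolynomial (Fin 2) ℂ, ∀ hp : Prime p, ¬p ∣ X 0 → ord hp θ ≤ 1) :
    ∃ (e : ℕ) (P : MvPolynomial (Fin 2) ℂ), θ * X0 ^ e = ev X0 X1 P := by
  set α := IsFractionRing.num (MvPolynomial (Fin 2) ℂ) θ with hα
  set β := IsFractionRing.den (MvPolynomial (Fin 2) ℂ) θ with hβ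
  have hβ0 : (β : MvPolynomial (Fin 2) ℂ) ≠ 0 := nonZeroDivisors.ne_zero β.2
  have hθ : θ * ev X0 X1 (β : MvPolynomial (Fin 2) ℂ) = ev X0 X1 α := by
    rw [ev_X0_X1, ev_X0_X1]
    have h1 := IsLocalization.mk'_spec K2 α β
    rwa [hα, hβ, IsFractionRing.mk'_num_den] at h1
  obtain ⟨e, γ, hγ⟩ := exists_dvd_pow (x := X 0) hβ0 fun p hp hpβ => by
    by_contra hpX
    obtain ⟨α', β', hβ', he⟩ := (ord_le_one_iff hp θ).mp (h p hp hpX)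
    have hβ'0 := ev_X0_X1_ne_zero (P := β') fun h0 => hβ' (h0 ▸ dvd_zero p)
    rw [eq_div_iff hβ'0] at he
    have h1 : α * β' = α' * β := by
      apply ev_X0_X1_injective
      rw [map_mul, map_mul, ← hθ, ← he]
      ring
    have h2 : p ∣ α * β' := h1 ▸ hpβ.mul_left α'
    refine hp.not_isUnit (IsFractionRing.num_den_reduced (MvPolynomial (Fin 2) ℂ) θ ?_ hpβ)
    exact (hp.dvd_or_dvd h2).resolve_right hβ'
  refine ⟨e, α * γ, ?_⟩
  have h1 := congrArg (ev X0 X1) hγ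
  rw [map_pow, ev_X_zero, map_mul] at h1
  rw [h1, map_mul, ← hθ, mul_assoc]

lemma Pt.univ_X0_X1 : Pt Set.univ X0 X1 := ⟨1, Set.mem_univ _, rfl, rfl⟩

lemma dd_map {ι : Cremona2} (h0 : ι X0 = X0) (h1 : ι X1 = X1⁻¹) (i : Fin 2) (D : Derivation ℂ K2 K2) (hx : ι (D X0) = dd i X0)
    (hy : ι (D X1) = dd i X1⁻¹) (f : K2) : dd i (ι f) = ι (D f) := by
  let D' : Derivation ℂ K2 K2 := Derivation.mk'
    (ι.symm.toLinearMap ∘ₗ (dd i : K2 →ₗ[ℂ] K2) ∘ₗ ι.toLinearMap)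
    (fun f g => by
      change ι.symm (dd i (ι (f * g))) = f * ι.symm (dd i (ι g)) + g * ι.symm (dd i (ι f))
      rw [map_mul, Derivation.leibniz, map_add, smul_eq_mul, smul_eq_mul, map_mul, map_mul,
        AlgEquiv.symm_apply_apply, AlgEquiv.symm_apply_apply])
  have hD' : ∀ f, D' f = ι.symm (dd i (ι f)) := fun f => rfl
  have h2 : (D' - D) f = 0 := by
    refine Pt.univ_X0_X1.derivation_eq_zero ?_ ?_ f
    · rw [Derivation.sub_apply, hD', h0, ← hx, AlgEquiv.symm_apply_apply, sub_self]
    · rw [Derivation.sub_apply, hD', h1, ← hy, AlgEquiv.symm_apply_apply, sub_self]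
  rw [Derivation.sub_apply, sub_eq_zero, hD', AlgEquiv.symm_apply_eq] at h2
  exact h2

/-- The chain rule for `(x, y) ↦ (x, y⁻¹)`. -/
lemma jac_map {ι : Cremona2} (h0 : ι X0 = X0) (h1 : ι X1 = X1⁻¹) (s t : K2) :
    X1 ^ 2 * jac (ι s) (ι t) = -ι (jac s t) := by
  have hX1 := X1_ne_zero
  have e1 : ∀ f, dd 0 (ι f) = ι (dd 0 f) := by
    refine dd_map h0 h1 0 (dd 0) ?_ ?_
    · simp [dd_X0]
    · rw [Derivation.leibniz_inv, dd_X1]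
      simp
  have e2 : ∀ f, dd 1 (ι f) = ι ((-X1 ^ 2 • dd 1) f) := by
    refine dd_map h0 h1 1 _ ?_ ?_
    · rw [Derivation.smul_apply, dd_X0]
      simp
    · rw [Derivation.leibniz_inv, Derivation.smul_apply, dd_X1, smul_eq_mul, smul_eq_mul]
      simp [h1]
  have e3 : ∀ f, ι ((-X1 ^ 2 • dd 1) f) * X1 ^ 2 = -ι (dd 1 f) := by
    intro f
    rw [Derivation.smul_apply, smul_eq_mul, map_mul, map_neg, map_pow, h1]
    field_simp
  rw [jac_apply, jac_apply, e1, e1, e2, e2, map_sub, map_mul, map_mul]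
  linear_combination ι (dd 0 s) * e3 t - ι (dd 0 t) * e3 s

/-- The key inequality at the curve `p = 0`. -/
def Reg {p : MvPolynomial (Fin 2) ℂ} (hp : Prime p) (A B : ℕ) (s t q : K2) : Prop :=
  ord hp (jac s t) ^ A ≤ ord hp q ^ B

/-- A rational pluricanonical form cannot be regular both on `ℂˣ × ℂ` and on the other chart of
`ℂˣ × ℙ¹`. -/
lemma false_of_reg {ι : Cremona2} (h0 : ι X0 = X0) (h1 : ι X1 = X1⁻¹) {s t q : K2} {A B : ℕ}
    (hA : A ≠ 0) (hq : q ≠ 0) (hJ : jac s t ≠ 0)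
    (hr : ∀ p : MvPolynomial (Fin 2) ℂ, ∀ hp : Prime p, ¬p ∣ X 0 → Reg hp A B s t q)
    (hr' : ∀ p : MvPolynomial (Fin 2) ℂ, ∀ hp : Prime p, ¬p ∣ X 0 →
      Reg hp A B (ι s) (ι t) (ι q)) : False := by
  have hX0 := X0_ne_zero
  have hX1 := X1_ne_zero
  have key : ∀ s t q : K2, q ≠ 0 →
      (∀ p : MvPolynomial (Fin 2) ℂ, ∀ hp : Prime p, ¬p ∣ X 0 → Reg hp A B s t q) →
      ∃ (e : ℕ) (P : MvPolynomial (Fin 2) ℂ), jac s t ^ A / q ^ B * X0 ^ e = ev X0 X1 P := by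
    intro s t q hq h
    refine exists_mul_X0_pow fun p hp hpX => ?_
    rw [map_div₀, map_pow, map_pow]
    have hv : 0 < ord hp q := zero_lt_iff.mpr ((ord hp).ne_zero_iff.mpr hq)
    exact div_le_one_of_le₀ (h p hp hpX) zero_le
  have hιq : ι q ≠ 0 := by simpa using hq
  obtain ⟨e, P, hP⟩ := key s t q hq hr
  obtain ⟨e', P', hP'⟩ := key (ι s) (ι t) (ι q) hιq hr'
  have hιP := congrArg ι hP
  rw [map_ev, h0, h1, map_mul, map_div₀, map_pow, map_pow, map_pow, h0] at hιP
  have hιJ : ι (jac s t) = -(X1 ^ 2 * jac (ι s) (ι t)) := by rw [jac_map h0 h1, neg_neg]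
  have hιP0 : ev X0 X1⁻¹ P ≠ 0 := by
    rw [← hιP]
    have : ι (jac s t) ≠ 0 := by simpa using hJ
    positivity
  obtain ⟨R, hR, hRP⟩ : X1 ^ P.degreeOf 1 * ev X0 X1⁻¹ P ∈
      PolyIn (fun _ j => j ≤ P.degreeOf 1) X0 X1 := by
    refine mul_mem_polyIn (T := fun _ j => j ≤ P.degreeOf 1) (s := X0) (t := X1⁻¹)
      (mem_polyIn.mpr ⟨P, fun d hd => degreeOf_le_iff.mp le_rfl d hd, rfl⟩) fun i j hj => ?_
    obtain ⟨k, hk⟩ := Nat.exists_eq_add_of_le hj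
    have h2 := monomial_mem_polyIn (T := fun _ j => j ≤ P.degreeOf 1) (i := i) (j := k)
      (by omega) X0 X1
    convert h2 using 1
    rw [hk, pow_add, inv_pow]
    field_simp
  have hRP' : ev X0 X1 R = X1 ^ P.degreeOf 1 * ev X0 X1⁻¹ P := hRP
  have heq : R * X 0 ^ e' = (-1) ^ A * X 1 ^ (P.degreeOf 1 + 2 * A) * P' * X 0 ^ e := by
    apply ev_X0_X1_injective
    simp only [map_mul, map_pow, map_neg, map_one, ev_X_zero, ev_X_one]
    rw [hRP', ← hP', ← hιP, hιJ, neg_pow, mul_pow, pow_add, pow_mul]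
    field_simp
  have hR0 : R ≠ 0 := by
    rintro rfl
    rw [map_zero] at hRP'
    exact mul_ne_zero (pow_ne_zero _ hX1) hιP0 hRP'.symm
  have hX0' : (X 0 : MvPolynomial (Fin 2) ℂ) ≠ 0 := X_ne_zero 0
  have hdvd : (X 1 : MvPolynomial (Fin 2) ℂ) ^ (P.degreeOf 1 + 2 * A) ∣ R * X 0 ^ e' := by
    rw [heq]
    exact ⟨(-1) ^ A * P' * X 0 ^ e, by ring⟩
  obtain ⟨W, hW⟩ := hdvd
  have hne : R * X 0 ^ e' ≠ 0 := mul_ne_zero hR0 (pow_ne_zero _ hX0')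
  have hdeg := congrArg (degreeOf 1) hW
  rw [hW] at hne
  rw [degreeOf_mul_eq hR0 (pow_ne_zero _ hX0'), degreeOf_mul_eq (left_ne_zero_of_mul hne)
    (right_ne_zero_of_mul hne), degreeOf_X_self_pow, degreeOf_X_pow_of_ne _ (by decide)] at hdeg
  have : R.degreeOf 1 ≤ P.degreeOf 1 := degreeOf_le_iff.mpr hR
  omega

lemma jac_inv_right (f g : K2) : jac f g⁻¹ = -(g ^ (-2 : ℤ) * jac f g) := by
  rw [Derivation.leibniz_inv, smul_eq_mul, zpow_neg]
  norm_cast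
  rw [inv_pow]
  ring

lemma jac_inv_left {s : K2} (hs : s ≠ 0) (t : K2) (n : ℤ) :
    jac s⁻¹ (t * s ^ (-n)) = -(s ^ (-(2 + n)) * jac s t) := by
  have h : s ^ (-(2 + n)) = s ^ (-2 : ℤ) * s ^ (-n) := by rw [neg_add, zpow_add₀ hs]
  rw [h, jac_comm, jac_inv_right, jac_comm s, Derivation.leibniz, Derivation.leibniz_zpow,
    jac_self, zsmul_eq_mul, smul_eq_mul, smul_eq_mul, smul_eq_mul]
  ring

lemma jac_add_algebraMap_left (s t : K2) (c : ℂ) : jac (s + algebraMap ℂ K2 c) t = jac s t := by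
  rw [jac_comm t, jac_comm t, map_add, Derivation.map_algebraMap, add_zero]

lemma jac_add_algebraMap_right (s t : K2) (c : ℂ) : jac s (t + algebraMap ℂ K2 c) = jac s t := by
  rw [map_add, Derivation.map_algebraMap, add_zero]

section

variable {p : MvPolynomial (Fin 2) ℂ} {hp : Prime p} {A B : ℕ} {s t q : K2}

lemma Reg.of_add_left {c : ℂ} (h : Reg hp A B (s + algebraMap ℂ K2 c) t q) : Reg hp A B s t q := by
  rwa [Reg, jac_add_algebraMap_left] at h

lemma Reg.of_add_right {c : ℂ} (h : Reg hp A B s (t + algebraMap ℂ K2 c) q) :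
    Reg hp A B s t q := by
  rwa [Reg, jac_add_algebraMap_right] at h

lemma Reg.swap (h : Reg hp A B s t q) : Reg hp A B t s q := by
  rwa [Reg, jac_comm s t, Valuation.map_neg]

lemma Reg.of_inv_right (ht : t ≠ 0) (h : Reg hp A 2 s t⁻¹ ((t ^ A)⁻¹ * q)) :
    Reg hp A 2 s t q := by
  rw [Reg, jac_inv_right, Valuation.map_neg, map_mul, map_zpow₀, map_mul, map_inv₀, map_pow,
    mul_pow, mul_pow, zpow_neg, inv_pow, inv_pow] at h
  have hv : 0 < ord hp t := zero_lt_iff.mpr ((ord hp).ne_zero_iff.mpr ht)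
  have h2 : (ord hp t ^ (2 : ℤ)) ^ A = (ord hp t ^ A) ^ 2 := by
    rw [zpow_ofNat, ← pow_mul, ← pow_mul, mul_comm]
  rw [h2] at h
  exact (mul_le_mul_iff_right₀ (inv_pos.mpr (pow_pos (pow_pos hv A) 2))).mp h

lemma Reg.of_inv_left {n b : ℤ} (hs : 1 ≤ ord hp s) (hb : (2 + n) * A ≤ b * B)
    (h : Reg hp A B s⁻¹ (t * s ^ (-n)) (s ^ (-b) * q)) : Reg hp A B s t q := by
  have hv : 0 < ord hp s := zero_lt_one.trans_le hs
  rw [Reg, jac_inv_left ((ord hp).ne_zero_iff.mp hv.ne'), Valuation.map_neg, map_mul, map_zpow₀,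
    map_mul, map_zpow₀, mul_pow, mul_pow, ← zpow_natCast (_ ^ _), ← zpow_mul,
    ← zpow_natCast (ord hp s ^ (-b)), ← zpow_mul] at h
  have h1 : ord hp s ^ (-b * B) ≤ ord hp s ^ (-(2 + n) * A) :=
    zpow_le_zpow_right₀ hs (by linarith)
  have h2 := h.trans (mul_le_mul' h1 le_rfl)
  exact (mul_le_mul_iff_right₀ (zpow_pos hv _)).mp h2

lemma Reg.of_one_le (hs : ord hp s ≤ 1) (ht : ord hp t ≤ 1) (hq : 1 ≤ ord hp q) :
    Reg hp A B s t q :=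
  (pow_le_one' (ord_jac_le_one hp hs ht) A).trans (one_le_pow₀ hq)

lemma ord_X0_mul (hpX : ¬p ∣ X 0) : ord hp (X0 * q) = ord hp q := by
  rw [map_mul, ← ev_X_zero X0 X1, ord_ev_eq_one hp hpX, one_mul]

/-- Either all exponents have degree at least `m`, or there is a monomial of small degree. -/
lemma Tup.or_reg {S : Set Cremona2} {T : ℕ → ℕ → Prop} (h : Tup S s t T q) (hpX : ¬p ∣ X 0)
    (hs : ord hp s < 1) (ht : ord hp t < 1) (m : ℕ) (hm : m * B ≤ A) :
    Tup S s t (fun i j => T i j ∧ m + 1 ≤ i + j) q ∨ Reg hp A B s t q := by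
  obtain ⟨Q, hQ, hQq⟩ := mem_polyIn.mp h.mem
  obtain ⟨P, hP, hPq⟩ := mem_polyIn.mp h.mul_mem
  have key : ∀ (R : MvPolynomial (Fin 2) ℂ) (d : Fin 2 →₀ ℕ), d ∈ R.support →
      ord hp (ev s t R) = ord hp q → d 0 + d 1 ≤ m → Reg hp A B s t q := by
    intro R d hd hR hdm
    have h1 := ord_jac_pow_le hp hs ht (mem_support_iff.mp hd)
    rw [hR] at h1
    have hJ := ord_jac_le_one hp hs.le ht.le
    calc ord hp (jac s t) ^ A ≤ ord hp (jac s t) ^ ((d 0 + d 1) * B) :=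
          pow_le_pow_right_of_le_one' hJ ((Nat.mul_le_mul_right B hdm).trans hm)
      _ ≤ ord hp q ^ B := by
          rw [pow_mul]
          exact pow_le_pow_left' h1 B
  by_contra! hcon
  refine hcon.1 ⟨h.pt, h.ne_zero, mem_polyIn.mpr ⟨Q, fun d hd => ⟨hQ d hd, ?_⟩, hQq⟩,
    mem_polyIn.mpr ⟨P, fun d hd => ⟨hP d hd, ?_⟩, hPq⟩⟩
  · by_contra! hlt
    exact hcon.2 (key Q d hd (by rw [hQq]) (by omega))
  · by_contra! hlt
    exact hcon.2 (key P d hd (by rw [hPq, ord_X0_mul hpX]) (by omega))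

end

lemma eq_aeval_of_degreeOf_eq_zero {g : MvPolynomial (Fin 2) ℂ} (h : g.degreeOf 1 = 0) :
    ∃ G : Polynomial ℂ, g = Polynomial.aeval (X 0) G := by
  refine ⟨aeval ![Polynomial.X, 0] g, ?_⟩
  have h1 : ∀ d ∈ g.support, d 1 = 0 := fun d hd =>
    Nat.le_zero.mp (degreeOf_le_iff.mp h.le d hd)
  conv_lhs => rw [g.as_sum]
  conv_rhs => rw [g.as_sum]
  rw [map_sum, map_sum]
  refine Finset.sum_congr rfl fun d hd => ?_
  rw [aeval_monomial, monomial_eq, Finsupp.prod_fintype _ _ (by simp),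
    Finsupp.prod_fintype _ _ (by simp)]
  simp [h1 d hd, MvPolynomial.algebraMap_eq]

lemma exists_linear_dvd {g : MvPolynomial (Fin 2) ℂ} (hg : Prime g) (h : g.degreeOf 1 = 0) :
    ∃ c : ℂ, X 0 - C c ∣ g := by
  obtain ⟨G, rfl⟩ := eq_aeval_of_degreeOf_eq_zero h
  have hG : G.degree ≠ 0 := by
    intro h0
    refine hg.not_isUnit ?_
    exact (Polynomial.isUnit_iff_degree_eq_zero.mpr h0).map (Polynomial.aeval (X 0))
  obtain ⟨c, hc⟩ := IsAlgClosed.exists_root G hG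
  refine ⟨c, ?_⟩
  have := map_dvd (Polynomial.aeval (X 0 : MvPolynomial (Fin 2) ℂ)) (Polynomial.dvd_iff_isRoot.mpr hc)
  simpa [MvPolynomial.algebraMap_eq] using this

lemma support_of_linear_mul {Q : MvPolynomial (Fin 2) ℂ} {c : ℂ} {T : ℕ → ℕ → Prop}
    (hT : ∀ i i' j, i' ≤ i → T i j → T i' j)
    (h : ∀ d ∈ ((X 0 - C c) * Q).support, T (d 0) (d 1)) (d : Fin 2 →₀ ℕ) (hd : d ∈ Q.support) :
    T (d 0 + 1) (d 1) := by
  obtain ⟨e, he, hmax⟩ := Finset.exists_max_image (Q.support.filter fun e => e 1 = d 1)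
    (fun e => e 0) ⟨d, by simpa using mem_support_iff.mp hd⟩
  rw [Finset.mem_filter] at he
  have hne : Q.coeff (e + Finsupp.single 0 1) = 0 := by
    by_contra h0
    have := hmax (e + Finsupp.single 0 1) (by simp [h0, he.2])
    simp at this
  have h1 : e + Finsupp.single 0 1 ∈ ((X 0 - C c) * Q).support := by
    rw [mem_support_iff, sub_mul, coeff_sub, mul_comm (X 0), coeff_mul_X, coeff_C_mul, hne,
      mul_zero, sub_zero]
    exact mem_support_iff.mp he.1
  have h2 := h _ h1
  simp only [Finsupp.add_apply, Finsupp.single_eq_same, he.2] at h2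
  have h3 : d 0 ≤ e 0 := hmax d (by simpa using mem_support_iff.mp hd)
  simpa using hT _ (d 0 + 1) _ (by omega) h2

lemma not_dvd_of_minimal {S : Set Cremona2} {a : ℕ}
    (ha : ∀ (s t : K2) (n : ℤ) (a' : ℕ) (b : ℤ) (q : K2), Tup S s t (Trap n a' b) q → a ≤ a')
    {s t : K2} {n b N : ℤ}
    (hN : ∀ (s t : K2) (n b : ℤ) (q : K2), Tup S s t (Trap n a b) q → N ≤ 2 * b - n * a)
    (h2 : 2 * b - n * a = N) (h : Pt S s t) {P Q g : MvPolynomial (Fin 2) ℂ} (hQ0 : Q ≠ 0)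
    (hP : ∀ d ∈ P.support, Trap n a b (d 0) (d 1)) (hQ : ∀ d ∈ Q.support, Trap n a b (d 0) (d 1))
    (hPQ : ev s t P = X0 * ev s t Q) (hg : Prime g) (hgP : g ∣ P) (hgQ : g ∣ Q) : False := by
  have hP0 : P ≠ 0 := by
    rintro rfl
    rw [map_zero] at hPQ
    exact mul_ne_zero X0_ne_zero (h.ev_ne_zero hQ0) hPQ.symm
  have hQa : Q.degreeOf 1 ≤ a := degreeOf_le_iff.mpr fun d hd => (hQ d hd).1
  have hPa : P.degreeOf 1 ≤ a := degreeOf_le_iff.mpr fun d hd => (hP d hd).1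
  by_cases hdeg : g.degreeOf 1 = 0
  · obtain ⟨c, hc⟩ := exists_linear_dvd hg hdeg
    obtain ⟨P', rfl⟩ := hc.trans hgP
    obtain ⟨Q', rfl⟩ := hc.trans hgQ
    have h1 := h.ev_ne_zero (left_ne_zero_of_mul hQ0)
    have h3 : Tup S s t (Trap n a (b - 1)) (ev s t Q') := by
      refine ⟨h, h.ev_ne_zero (right_ne_zero_of_mul hQ0), mem_polyIn.mpr ⟨Q', fun d hd => ?_, rfl⟩,
        mem_polyIn.mpr ⟨P', fun d hd => ?_, ?_⟩⟩
      · have := support_of_linear_mul Trap.left_le hQ d hd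
        exact ⟨this.1, by have := this.2; push_cast at this; linarith⟩
      · have := support_of_linear_mul Trap.left_le hP d hd
        exact ⟨this.1, by have := this.2; push_cast at this; linarith⟩
      · rw [map_mul, map_mul] at hPQ
        exact mul_left_cancel₀ h1 (by rw [hPQ]; ring)
    have := hN _ _ _ _ _ h3
    linarith
  · obtain ⟨P', rfl⟩ := hgP
    obtain ⟨Q', rfl⟩ := hgQ
    have h1 := h.ev_ne_zero hg.ne_zero
    rw [degreeOf_mul_eq (left_ne_zero_of_mul hQ0) (right_ne_zero_of_mul hQ0)] at hQa
    rw [degreeOf_mul_eq (left_ne_zero_of_mul hP0) (right_ne_zero_of_mul hP0)] at hPa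
    have h3 : ev s t P' = X0 * ev s t Q' := by
      rw [map_mul, map_mul] at hPQ
      exact mul_left_cancel₀ h1 (by rw [hPQ]; ring)
    obtain ⟨b', hb'⟩ := Tup.of_polynomials h (right_ne_zero_of_mul hQ0) h3 (a := a - 1) (by omega)
      (by omega)
    have := ha _ _ _ _ _ _ hb'
    omega

lemma reg_of_minimal {S : Set Cremona2} {a : ℕ} (hS : RightStable S)
    (ha : ∀ (s t : K2) (n : ℤ) (a' : ℕ) (b : ℤ) (q : K2), Tup S s t (Trap n a' b) q → a ≤ a')
    {N : ℤ} (hN : ∀ (s t : K2) (n b : ℤ) (q : K2), Tup S s t (Trap n a b) q → N ≤ 2 * b - n * a)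
    (hNa : 2 * a ≤ N) {p : MvPolynomial (Fin 2) ℂ} (hp : Prime p) (hpX : ¬p ∣ X 0)
    {s t q : K2} {n b : ℤ} (h : Tup S s t (Trap n a b) q) (h2 : 2 * b - n * a = N) :
    Reg hp a 2 s t q := by
  have origin : ∀ {s t q : K2} {n b : ℤ}, Tup S s t (Trap n a b) q → 2 * b - n * a = N →
      ord hp s < 1 → ord hp t < 1 → Reg hp a 2 s t q := by
    intro s t q n b h h2 hs ht
    rcases h.or_reg (A := a) (B := 2) hpX hs ht (a / 2) (by omega) with h3 | h3
    · have h4 := hN _ _ _ _ _ (h3.elementary hS)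
      have h5 : (a : ℤ) < 2 * ((a / 2 + 1 : ℕ) : ℤ) := by
        push_cast
        omega
      linarith
    · exact h3
  have core : ∀ {s t q : K2} {n b : ℤ}, Tup S s t (Trap n a b) q → 2 * b - n * a = N →
      ord hp s ≤ 1 → ord hp t ≤ 1 → 0 ≤ n ∨ ord hp t < 1 → Reg hp a 2 s t q := by
    intro s t q n b h h2 hs ht hn
    rcases le_or_gt 1 (ord hp q) with hq | hq
    · exact Reg.of_one_le hs ht hq
    obtain ⟨Q, hQ, hQq⟩ := mem_polyIn.mp h.mem
    obtain ⟨P, hP, hPq⟩ := mem_polyIn.mp h.mul_mem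
    have hQ0 : Q ≠ 0 := by
      rintro rfl
      exact h.ne_zero (by rw [← hQq, map_zero])
    rcases exists_center hp hs ht (P := P) hQ0 (by rwa [hPq, ord_X0_mul hpX]) (by rwa [hQq]) with
      ⟨g, hg, hgP, hgQ⟩ | ⟨c, e, hc, he⟩
    · exact (not_dvd_of_minimal ha hN h2 h.pt hQ0 hP hQ (by rw [hPq, hQq]) hg hgP hgQ).elim
    · have h3 := h.add_left hS c Trap.left_le
      refine Reg.of_add_left (c := c) ?_
      by_cases hlt : ord hp t < 1
      · exact origin h3 h2 hc hlt
      · have hn' := hn.resolve_right hlt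
        exact Reg.of_add_right (origin (h3.add_right hS e (Trap.right_le hn')) h2 hc he)
  have left : ∀ {s t q : K2} {n b : ℤ}, Tup S s t (Trap n a b) q → 2 * b - n * a = N →
      ord hp s ≤ 1 → Reg hp a 2 s t q := by
    intro s t q n b h h2 hs
    have ht0 := h.pt.right_ne_zero
    have hv : 0 < ord hp t := zero_lt_iff.mpr ((ord hp).ne_zero_iff.mpr ht0)
    have flip : 1 ≤ ord hp t → 0 ≤ -n ∨ 1 < ord hp t → Reg hp a 2 s t q := by
      intro ht hn
      refine Reg.of_inv_right ht0 (core (h.inv_right hS) (by linarith) hs ?_ ?_)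
      · rw [map_inv₀]
        exact inv_le_one_of_one_le₀ ht
      · refine hn.imp_right fun ht => ?_
        rw [map_inv₀]
        exact inv_lt_one_of_one_lt₀ ht
    rcases lt_trichotomy (ord hp t) 1 with ht | ht | ht
    · exact core h h2 hs ht.le (Or.inr ht)
    · rcases le_total 0 n with hn | hn
      · exact core h h2 hs ht.le (Or.inl hn)
      · exact flip ht.ge (Or.inl (by linarith))
    · exact flip ht.le (Or.inr ht)
  rcases le_or_gt (ord hp s) 1 with hs | hs
  · exact left h h2 hs
  · refine Reg.of_inv_left (n := n) (b := b) hs.le ?_ (left (h.inv_left hS) h2 ?_)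
    · push_cast
      linarith
    · rw [map_inv₀]
      exact inv_le_one_of_one_le₀ hs.le

lemma reg_of_minimal_degree {S : Set Cremona2} {a : ℕ} (hS : RightStable S)
    (ha : ∀ (s t : K2) (n : ℤ) (a' : ℕ) (b : ℤ) (q : K2), Tup S s t (Trap n a' b) q → a ≤ a')
    (ha0 : a ≠ 0) {d : ℕ} (hd : ∀ (s t : K2) (d' : ℕ) (q : K2), Tup S s t (Trap 1 d' d') q → d ≤ d')
    (hda : 2 * d ≤ 3 * a) {p : MvPolynomial (Fin 2) ℂ} (hp : Prime p) (hpX : ¬p ∣ X 0)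
    {s t q : K2} (h : Tup S s t (Trap 1 d d) q) : Reg hp d 3 s t q := by
  have had : a ≤ d := ha _ _ _ _ _ _ h
  have core : ∀ {s t q : K2}, Tup S s t (Trap 1 d d) q → ord hp s ≤ 1 → ord hp t ≤ 1 →
      Reg hp d 3 s t q := by
    intro s t q h hs ht
    rcases le_or_gt 1 (ord hp q) with hq | hq
    · exact Reg.of_one_le hs ht hq
    obtain ⟨Q, hQ, hQq⟩ := mem_polyIn.mp h.mem
    obtain ⟨P, hP, hPq⟩ := mem_polyIn.mp h.mul_mem
    have hQ0 : Q ≠ 0 := by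
      rintro rfl
      exact h.ne_zero (by rw [← hQq, map_zero])
    have hP0 : P ≠ 0 := by
      rintro rfl
      exact mul_ne_zero X0_ne_zero h.ne_zero (by rw [← hPq, map_zero])
    rcases exists_center hp hs ht (P := P) hQ0 (by rwa [hPq, ord_X0_mul hpX]) (by rwa [hQq]) with
      ⟨g, hg, ⟨P', rfl⟩, ⟨Q', rfl⟩⟩ | ⟨c, e, hc, he⟩
    · have hdeg : ∀ R : MvPolynomial (Fin 2) ℂ,
          (∀ e ∈ R.support, Trap 1 d d (e 0) (e 1)) ↔ R.totalDegree ≤ d := by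
        intro R
        rw [totalDegree, Finset.sup_le_iff]
        refine forall₂_congr fun e _ => ?_
        rw [Finsupp.sum_fintype _ _ (by simp), Fin.sum_univ_two, Trap]
        omega
      have hg1 : g.totalDegree ≠ 0 := by
        intro h0
        rw [totalDegree_eq_zero_iff_eq_C] at h0
        refine hg.not_isUnit ?_
        rw [h0]
        refine (isUnit_iff_ne_zero.mpr fun h1 => hg.ne_zero ?_).map C
        rw [h0, h1, C_0]
      have h1 := (hdeg _).mp hP
      have h2 := (hdeg _).mp hQ
      rw [totalDegree_mul_of_isDomain (left_ne_zero_of_mul hP0) (right_ne_zero_of_mul hP0)] at h1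
      rw [totalDegree_mul_of_isDomain (left_ne_zero_of_mul hQ0) (right_ne_zero_of_mul hQ0)] at h2
      have hdeg' : ∀ R : MvPolynomial (Fin 2) ℂ, R.totalDegree ≤ d - 1 →
          ∀ e ∈ R.support, Trap 1 (d - 1) (d - 1 : ℕ) (e 0) (e 1) := by
        intro R hR e he
        have := (Finset.sup_le_iff.mp hR) e he
        rw [Finsupp.sum_fintype _ _ (by simp), Fin.sum_univ_two] at this
        rw [Trap]
        omega
      have h3 : Tup S s t (Trap 1 (d - 1) (d - 1 : ℕ)) (ev s t Q') := by
        refine ⟨h.pt, h.pt.ev_ne_zero (right_ne_zero_of_mul hQ0),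
          mem_polyIn.mpr ⟨Q', hdeg' _ (by omega), rfl⟩,
          mem_polyIn.mpr ⟨P', hdeg' _ (by omega), ?_⟩⟩
        refine mul_left_cancel₀ (h.pt.ev_ne_zero hg.ne_zero) ?_
        rw [← map_mul, hPq, ← hQq, map_mul]
        ring
      have := hd _ _ _ _ h3
      omega
    · have h3 := (h.add_left hS c Trap.left_le).add_right hS e (Trap.right_le zero_le_one)
      refine Reg.of_add_left (c := c) (Reg.of_add_right (c := e) ?_)
      rcases h3.or_reg (A := d) (B := 3) hpX hc he (d - a) (by omega) with h4 | h4
      · have h5 : Tup S _ _ (Trap 0 (a - 1) d) _ :=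
          ((h4.elementary hS).swap hS).mono fun i j hij => by
            obtain ⟨h6, h7⟩ := hij
            constructor
            · push_cast at h7
              omega
            · simpa using h6
        have := ha _ _ _ _ _ _ h5
        omega
      · exact h4
  have big : ∀ {s t q : K2}, Tup S s t (Trap 1 d d) q → 1 < ord hp s → ord hp t ≤ ord hp s →
      Reg hp d 3 s t q := by
    intro s t q h hs hts
    refine Reg.of_inv_left (n := 1) (b := d) hs.le ?_ (core (h.inv_left hS) ?_ ?_)
    · push_cast
      linarith
    · rw [map_inv₀]
      exact inv_le_one_of_one_le₀ hs.le
    · rw [map_mul, zpow_neg_one, map_inv₀]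
      exact mul_inv_le_one_of_le₀ hts zero_le
  rcases le_total (ord hp t) (ord hp s) with hts | hst
  · rcases le_or_gt (ord hp s) 1 with hs | hs
    · exact core h hs (hts.trans hs)
    · exact big h hs hts
  · rcases le_or_gt (ord hp t) 1 with ht | ht
    · exact core h (hst.trans ht) ht
    · refine (big ((h.swap hS).mono fun i j hij => ?_) ht hst).swap
      rw [Trap] at hij ⊢
      omega

lemma Pt.map {S : Set Cremona2} {ι : Cremona2} (hι : ∀ ψ ∈ S, ι * ψ ∈ S) {s t : K2}
    (h : Pt S s t) : Pt S (ι s) (ι t) := by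
  obtain ⟨ψ, hψ, rfl, rfl⟩ := h
  exact ⟨ι * ψ, hι ψ hψ, rfl, rfl⟩

lemma Tup.map_left {S : Set Cremona2} {ι : Cremona2} (hι : ∀ ψ ∈ S, ι * ψ ∈ S) (h0 : ι X0 = X0)
    {s t q : K2} {T : ℕ → ℕ → Prop} (h : Tup S s t T q) : Tup S (ι s) (ι t) T (ι q) where
  pt := h.pt.map hι
  ne_zero := by simpa using h.ne_zero
  mem := map_mem_polyIn ι h.mem
  mul_mem := by
    have := map_mem_polyIn ι h.mul_mem
    rwa [map_mul, h0] at this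

/-- A stable set of Cremona transformations none of which fixes `x` is empty. -/
lemma eq_empty_of_rightStable {S : Set Cremona2} (hS : RightStable S) {ι : Cremona2}
    (h0 : ι X0 = X0) (h1 : ι X1 = X1⁻¹) (hι : ∀ ψ ∈ S, ι * ψ ∈ S) (hX : ∀ t, ¬Pt S X0 t) :
    S = ∅ := by
  by_contra hne
  obtain ⟨ψ, hψ⟩ := Set.nonempty_iff_ne_empty.mpr hne
  have hex : ∃ a, ∃ (s t : K2) (n b : ℤ) (q : K2), Tup S s t (Trap n a b) q := by
    obtain ⟨a, b, q, h⟩ := Pt.exists_tup (S := S) ⟨ψ, hψ, rfl, rfl⟩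
    exact ⟨a, _, _, _, b, q, h⟩
  classical
  obtain ⟨a, hmin, ha⟩ : ∃ a, (∃ (s t : K2) (n b : ℤ) (q : K2), Tup S s t (Trap n a b) q) ∧
      ∀ (s t : K2) (n : ℤ) (a' : ℕ) (b : ℤ) (q : K2), Tup S s t (Trap n a' b) q → a ≤ a' :=
    ⟨Nat.find hex, Nat.find_spec hex, fun s t n a' b q h =>
      Nat.find_min' hex ⟨s, t, n, b, q, h⟩⟩
  have ha0 : a ≠ 0 := by
    rintro rfl
    obtain ⟨s, t, n, b, q, h⟩ := hmin
    exact hX t (h.pt_X0 hS)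
  have hle : ∀ (s t : K2) (n b : ℤ) (q : K2), Tup S s t (Trap n a b) q → n * a ≤ b := by
    intro s t n b q h
    by_contra! hlt
    have h2 : Tup S s t (Trap n (a - 1) b) q := by
      refine Tup.mono h fun i j hij => ⟨?_, hij.2⟩
      obtain ⟨hj, hb⟩ := hij
      rcases hj.lt_or_eq with hj | rfl
      · omega
      · omega
    have := ha _ _ _ _ _ _ h2
    omega
  have hpos : ∀ (s t : K2) (n b : ℤ) (q : K2), Tup S s t (Trap n a b) q → 0 ≤ b := by
    intro s t n b q h
    have := hle _ _ _ _ _ (h.inv_right hS)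
    linarith
  obtain ⟨N, ⟨s₀, t₀, n₀, b₀, q₀, h, hN₀⟩, hN⟩ : ∃ N : ℤ,
      (∃ (s t : K2) (n b : ℤ) (q : K2), Tup S s t (Trap n a b) q ∧ 2 * b - n * a = N) ∧
      ∀ (s t : K2) (n b : ℤ) (q : K2), Tup S s t (Trap n a b) q → N ≤ 2 * b - n * a := by
    obtain ⟨N, h, hN⟩ := Int.exists_least_of_bdd (P := fun N : ℤ =>
      ∃ (s t : K2) (n b : ℤ) (q : K2), Tup S s t (Trap n a b) q ∧ 2 * b - n * a = N)
      ⟨0, by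
        rintro _ ⟨s, t, n, b, q, h, rfl⟩
        linarith [hle _ _ _ _ _ h, hpos _ _ _ _ _ h]⟩
      (by
        obtain ⟨s, t, n, b, q, h⟩ := hmin
        exact ⟨_, s, t, n, b, q, h, rfl⟩)
    exact ⟨N, h, fun s t n b q h => hN _ ⟨s, t, n, b, q, h, rfl⟩⟩
  rcases le_or_gt (2 * (a : ℤ)) N with hNa | hNa
  · exact false_of_reg h0 h1 ha0 h.ne_zero h.pt.jac_ne_zero
      (fun p hp hpX => reg_of_minimal hS ha hN hNa hp hpX h hN₀)
      (fun p hp hpX => reg_of_minimal hS ha hN hNa hp hpX (h.map_left hι h0) hN₀)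
  obtain ⟨s, t, n, b, q, h, hn, hb⟩ : ∃ (s t : K2) (n b : ℤ) (q : K2),
      Tup S s t (Trap n a b) q ∧ 0 ≤ n ∧ 2 * b - n * a < 2 * a := by
    rcases le_total 0 n₀ with hn | hn
    · exact ⟨s₀, t₀, n₀, b₀, q₀, h, hn, by linarith⟩
    · exact ⟨_, _, _, _, _, h.inv_right hS, by linarith, by linarith⟩
  have hna := hle _ _ _ _ _ h
  have hb0 := hpos _ _ _ _ _ h
  have hn2 : n < 2 := by
    by_contra! hn2
    nlinarith
  obtain ⟨k, rfl⟩ := Int.eq_ofNat_of_zero_le hb0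
  obtain rfl | rfl : n = 0 ∨ n = 1 := by omega
  · have h2 : Tup S t s (Trap 0 k a) q := (h.swap hS).mono fun i j hij => by
      rw [Trap] at hij ⊢
      omega
    have := ha _ _ _ _ _ _ h2
    omega
  · have hex : ∃ d : ℕ, ∃ (s t q : K2), Tup S s t (Trap 1 d d) q :=
      ⟨k, s, t, q, h.mono fun i j hij => by rw [Trap] at hij ⊢; omega⟩
    obtain ⟨d, hdk, ⟨s, t, q, h⟩, hd⟩ : ∃ d ≤ k, (∃ (s t q : K2), Tup S s t (Trap 1 d d) q) ∧
        ∀ (s t : K2) (d' : ℕ) (q : K2), Tup S s t (Trap 1 d' d') q → d ≤ d' :=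
      ⟨Nat.find hex, Nat.find_min' hex ⟨s, t, q, h.mono fun i j hij => by
        rw [Trap] at hij ⊢; omega⟩, Nat.find_spec hex,
        fun s t d' q h => Nat.find_min' hex ⟨s, t, q, h⟩⟩
    have had := ha _ _ _ _ _ _ h
    exact false_of_reg (A := d) h0 h1 (by omega) h.ne_zero h.pt.jac_ne_zero
      (fun p hp hpX => reg_of_minimal_degree hS ha ha0 hd (by omega) hp hpX h)
      (fun p hp hpX => reg_of_minimal_degree hS ha ha0 hd (by omega) hp hpX (h.map_left hι h0))

end PlaneCremona

/-- **Theorem of Noether and Castelnuovo.** The plane Cremona group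
`Bir(ℙ²_ℂ) = Aut_ℂ(ℂ(x,y))` is generated by the standard quadratic involution `σ₂`
(determined by `σ₂(x) = 1/x`, `σ₂(y) = 1/y`) together with the linear automorphisms. -/
theorem noether_castelnuovo (σ₂ : Cremona2) (hx : σ₂ X0 = X0⁻¹) (hy : σ₂ X1 = X1⁻¹) :
    Subgroup.closure ({σ₂} ∪ {f : Cremona2 | IsLinearAut f}) = ⊤ := by
  set G := Subgroup.closure ({σ₂} ∪ {f : Cremona2 | IsLinearAut f}) with hG
  have hlin : ∀ g, IsLinearAut g → g ∈ G := fun g hg =>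
    Subgroup.subset_closure (Or.inr hg)
  have hquad : ∀ g : Cremona2, g X0 = X0⁻¹ → g X1 = X1⁻¹ → g ∈ G := by
    intro g h0 h1
    rw [PlaneCremona.cremona_ext (h0.trans hx.symm) (h1.trans hy.symm)]
    exact Subgroup.subset_closure (Or.inl rfl)
  have hS : PlaneCremona.RightStable (G : Set Cremona2) :=
    ⟨fun ψ hψ g hg => mul_mem hψ (hlin g hg), fun ψ hψ g h0 h1 => mul_mem hψ (hquad g h0 h1),
      ⟨σ₂, hx, hy⟩⟩
  have hS' : PlaneCremona.RightStable ((G : Set Cremona2)ᶜ) :=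
    ⟨fun ψ hψ g hg h => hψ ((Subgroup.mul_mem_cancel_right G (hlin g hg)).mp h),
      fun ψ hψ g h0 h1 h => hψ ((Subgroup.mul_mem_cancel_right G (hquad g h0 h1)).mp h),
      ⟨σ₂, hx, hy⟩⟩
  obtain ⟨ι, hι, h0, h1⟩ := PlaneCremona.Pt.inv_right hS (s := X0) (t := X1) ⟨1, one_mem G, rfl, rfl⟩
  have hempty := PlaneCremona.eq_empty_of_rightStable hS' h0 h1
    (fun ψ hψ h => hψ ((Subgroup.mul_mem_cancel_left G hι).mp h)) (by
      rintro t ⟨ψ, hψ, hψ0, -⟩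
      exact hψ (PlaneCremona.Pt.mem_of_left_eq hS (one_mem G) hψ0))
  rw [Set.compl_empty_iff] at hempty
  exact SetLike.coe_injective (hempty.trans Subgroup.coe_top.symm)
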